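/- Let m < n, let M be an m-space group and let Δ be an (n−m)-space group. Let Hom_f(Δ, Out(M)) be the set of group homomorphisms from Δ to Out(M) with finite image, and declare η₁ ∼ η₂ if there exist g ∈ Out(M) and β ∈ Aut(Δ) such that η₂(δ) = g·η₁(β(δ))·g⁻¹ for all δ ∈ Δ. Then the quotient set Out(Δ, M) = Hom_f(Δ, Out(M))/∼ is finite. -/

import Mathlib

noncomputable section

/-- The translation `x ↦ a + x` of a normed additive group, as an isometry. -/
def transIso {X : Type*} [SeminormedAddCommGroup X] (a : X) : X ≃ᵢ X :=
  IsometryEquiv.constVAdd a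

@[simp] lemma transIso_apply {X : Type*} [SeminormedAddCommGroup X] (a x : X) :
    transIso a x = a + x := rfl

/-- `parts φ a A` means that the isometry `φ` is `a + A`, i.e. `φ x = a + A x` for all `x`. -/
def parts {X : Type*} [NormedAddCommGroup X] [InnerProductSpace ℝ X]
    (φ : X ≃ᵢ X) (a : X) (A : X ≃ₗᵢ[ℝ] X) : Prop :=
  ∀ x, φ x = a + A x

/-- The span of a group of isometries: the real span of the set of translation vectors of
the translations belonging to the group. -/
def spanOf {X : Type*} [NormedAddCommGroup X] [InnerProductSpace ℝ X]
    (H : Subgroup (X ≃ᵢ X)) : Submodule ℝ X :=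
  Submodule.span ℝ {a : X | transIso a ∈ H}

/-- A space group: a group of isometries acting discontinuously (the discreteness condition)
with compact quotient (expressed by a compact set meeting every orbit). -/
def IsSpaceGroup {X : Type*} [MetricSpace X] (Γ : Subgroup (X ≃ᵢ X)) : Prop :=
  (∀ K : Set X, IsCompact K →
    {γ : X ≃ᵢ X | γ ∈ Γ ∧ ((γ : X → X) '' K ∩ K).Nonempty}.Finite) ∧
  ∃ K : Set X, IsCompact K ∧ ∀ x : X, ∃ γ ∈ Γ, (γ : X → X) x ∈ K

/-- `N` is a complete normal subgroup of `Γ`: it is normal in `Γ` and consists exactly of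
those `a + A ∈ Γ` with `a ∈ Span N` and `A` fixing `(Span N)ᗮ` pointwise. -/
def IsCompleteNormal {X : Type*} [NormedAddCommGroup X] [InnerProductSpace ℝ X]
    (Γ N : Subgroup (X ≃ᵢ X)) : Prop :=
  N ≤ Γ ∧ (∀ γ ∈ Γ, ∀ ν ∈ N, γ * ν * γ⁻¹ ∈ N) ∧
  ∀ φ ∈ Γ, ∀ (a : X) (A : X ≃ₗᵢ[ℝ] X), parts φ a A →
    (φ ∈ N ↔ a ∈ spanOf N ∧ ∀ w ∈ (spanOf N)ᗮ, A w = w)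

/-- The real span of the set of translation vectors of the central translations of `N`,
i.e. `Span(Z(N))`. -/
def centerSpan {X : Type*} [NormedAddCommGroup X] [InnerProductSpace ℝ X]
    (N : Subgroup (X ≃ᵢ X)) : Submodule ℝ X :=
  Submodule.span ℝ
    {u : X | ∃ h : transIso u ∈ N, (⟨transIso u, h⟩ : N) ∈ Subgroup.center N}


/-- The group `Inn(G)` of inner automorphisms, as a subgroup of `Aut(G)`. -/
def Inn (G : Type*) [Group G] : Subgroup (MulAut G) := (MulAut.conj (G := G)).range

instance Inn.normal (G : Type*) [Group G] : (Inn G).Normal := by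
  constructor
  rintro x ⟨g, rfl⟩ ζ
  refine ⟨ζ g, ?_⟩
  ext h
  simp [MulAut.conj]

/-- The outer automorphism group `Out(G) = Aut(G)/Inn(G)`. -/
abbrev Out (G : Type*) [Group G] := MulAut G ⧸ Inn G

section Geometry

/-- The iterated commutators `[α, [α, …, [α, β]]]`. -/
def iterComm {G : Type*} [Group G] (α β : G) : ℕ → G
  | 0 => β
  | k + 1 => α * iterComm α β k * α⁻¹ * (iterComm α β k)⁻¹

lemma iterComm_mem {G : Type*} [Group G] {M : Subgroup G} {α β : G} (hα : α ∈ M) (hβ : β ∈ M) (k : ℕ) :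
    iterComm α β k ∈ M := by
  induction k with
  | zero => exact hβ
  | succ k ih => exact M.mul_mem (M.mul_mem (M.mul_mem hα ih) (M.inv_mem hα)) (M.inv_mem ih)

lemma IsSpaceGroup.exists_near {X : Type*} [NormedAddCommGroup X] {M : Subgroup (X ≃ᵢ X)}
    (hM : IsSpaceGroup M) : ∃ R : ℝ, 0 ≤ R ∧ ∀ x : X, ∃ γ ∈ M, ‖γ 0 - x‖ ≤ R := by
  obtain ⟨K, hK, h⟩ := hM.2
  obtain ⟨R, hR⟩ := hK.isBounded.subset_closedBall 0
  refine ⟨max R 0, le_max_right _ _, fun x ↦ ?_⟩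
  obtain ⟨γ, hγ, hx⟩ := h x
  refine ⟨γ⁻¹, M.inv_mem hγ, ?_⟩
  have h1 := hR hx
  rw [Metric.mem_closedBall, ← (γ⁻¹).isometry.dist_eq] at h1
  rw [← dist_eq_norm, dist_comm]
  have h2 : γ⁻¹ (γ x) = x := DFunLike.congr_fun (inv_mul_cancel γ) x
  rw [h2] at h1
  exact h1.trans (le_max_left _ _)

variable {X : Type*} [NormedAddCommGroup X] [InnerProductSpace ℝ X]

/-- The linear part of an isometry of a Euclidean space. -/
def linPart : (X ≃ᵢ X) →* (X →L[ℝ] X) where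
  toFun φ := φ.toRealLinearIsometryEquiv.toContinuousLinearEquiv
  map_one' := by ext x; simp
  map_mul' φ ψ := by
    ext x
    have h := φ.toRealLinearIsometryEquiv.map_sub (ψ x) (ψ 0)
    simp only [IsometryEquiv.toRealLinearIsometryEquiv_apply] at h
    simp [h]

lemma linPart_apply (φ : X ≃ᵢ X) (x : X) : linPart φ x = φ x - φ 0 := by
  simp [linPart]

lemma apply_eq_linPart (φ : X ≃ᵢ X) (x : X) : φ x = linPart φ x + φ 0 := by
  simp [linPart_apply]

@[simp] lemma norm_linPart_apply (φ : X ≃ᵢ X) (x : X) : ‖linPart φ x‖ = ‖x‖ :=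
  φ.toRealLinearIsometryEquiv.norm_map x

lemma norm_linPart_le (φ : X ≃ᵢ X) : ‖linPart φ‖ ≤ 1 :=
  ContinuousLinearMap.opNorm_le_bound _ zero_le_one (by simp)

lemma linPart_mul_inv (φ : X ≃ᵢ X) : linPart φ * linPart φ⁻¹ = 1 := by
  rw [← map_mul, mul_inv_cancel, map_one]

lemma linPart_inv_mul (φ : X ≃ᵢ X) : linPart φ⁻¹ * linPart φ = 1 := by
  rw [← map_mul, inv_mul_cancel, map_one]

lemma norm_mul_linPart_le (T : X →L[ℝ] X) (φ : X ≃ᵢ X) : ‖T * linPart φ‖ ≤ ‖T‖ :=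
  (norm_mul_le _ _).trans (mul_le_of_le_one_right (norm_nonneg _) (norm_linPart_le φ))

lemma norm_linPart_mul_le (T : X →L[ℝ] X) (φ : X ≃ᵢ X) : ‖linPart φ * T‖ ≤ ‖T‖ :=
  (norm_mul_le _ _).trans (mul_le_of_le_one_left (norm_nonneg _) (norm_linPart_le φ))

lemma norm_linPart_comm_sub_one_le (α β : X ≃ᵢ X) :
    ‖linPart (α * β * α⁻¹ * β⁻¹) - 1‖ ≤ 2 * ‖linPart α - 1‖ * ‖linPart β - 1‖ := by
  have h : linPart (α * β * α⁻¹ * β⁻¹) - 1 =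
      ((linPart α - 1) * (linPart β - 1) - (linPart β - 1) * (linPart α - 1)) *
        linPart (α⁻¹ * β⁻¹) := by
    have h1 : linPart (β * α) * linPart (α⁻¹ * β⁻¹) = 1 := by
      rw [← map_mul, show β * α * (α⁻¹ * β⁻¹) = 1 by group, map_one]
    have h2 : linPart (α * β * α⁻¹ * β⁻¹) = linPart (α * β) * linPart (α⁻¹ * β⁻¹) := by
      rw [← map_mul]; congr 1
    have h3 : (linPart α - 1) * (linPart β - 1) - (linPart β - 1) * (linPart α - 1) =
        linPart (α * β) - linPart (β * α) := by
      rw [map_mul, map_mul]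
      noncomm_ring
    rw [h3, sub_mul, h1, h2]
  rw [h]
  refine (norm_mul_linPart_le _ _).trans ((norm_sub_le _ _).trans ?_)
  have h1 := norm_mul_le (linPart α - 1) (linPart β - 1)
  have h2 := norm_mul_le (linPart β - 1) (linPart α - 1)
  linarith

lemma eq_one_of_linPart_eq_one {φ : X ≃ᵢ X} (h : linPart φ = 1) (h0 : φ 0 = 0) : φ = 1 := by
  ext x
  rw [apply_eq_linPart, h, h0]
  simp

/-- An isometry all of whose powers have linear part close to the identity is a translation. -/
lemma linPart_eq_one_of_pow (φ : X ≃ᵢ X) (h : ∀ n : ℕ, ‖linPart (φ ^ n) - 1‖ ≤ 1 / 2) :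
    linPart φ = 1 := by
  have key : ∀ k : ℕ, (3 / 2 : ℝ) ^ k * ‖linPart φ - 1‖ ≤ ‖linPart (φ ^ 2 ^ k) - 1‖ := by
    intro k
    induction k with
    | zero => simp
    | succ k ih =>
      set C := linPart (φ ^ 2 ^ k) with hC
      have h1 : linPart (φ ^ 2 ^ (k + 1)) - 1 = (C - 1) + (C - 1) + (C - 1) * (C - 1) := by
        rw [pow_succ, pow_mul, pow_two, map_mul, ← hC]
        noncomm_ring
      have h2 : (C - 1) + (C - 1) = (linPart (φ ^ 2 ^ (k + 1)) - 1) - (C - 1) * (C - 1) := by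
        rw [h1]; abel
      have h3 := norm_sub_le (linPart (φ ^ 2 ^ (k + 1)) - 1) ((C - 1) * (C - 1))
      rw [← h2, ← two_smul ℝ, norm_smul] at h3
      have h4 := norm_mul_le (C - 1) (C - 1)
      have h5 := h (2 ^ k)
      rw [← hC] at h5
      rw [Real.norm_two] at h3
      rw [pow_succ]
      nlinarith [norm_nonneg (C - 1)]
  by_contra hne
  have hpos : 0 < ‖linPart φ - 1‖ := norm_pos_iff.2 (sub_ne_zero.2 hne)
  obtain ⟨k, hk⟩ := pow_unbounded_of_one_lt (1 / ‖linPart φ - 1‖) (show (1 : ℝ) < 3 / 2 by norm_num)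
  have h1 := key k
  have h2 := h (2 ^ k)
  rw [div_lt_iff₀ hpos] at hk
  linarith

/-- If `A` commutes with the commutator of `A` and `B`, where `B` is close to the identity,
then `A` commutes with `B`. -/
lemma linPart_comm_eq_one (α β : X ≃ᵢ X) (hβ : ‖linPart β - 1‖ ≤ 1 / 4)
    (h : linPart (α * (α * β * α⁻¹ * β⁻¹)) = linPart ((α * β * α⁻¹ * β⁻¹) * α)) :
    linPart (α * β * α⁻¹ * β⁻¹) = 1 := by
  set γ := α * β * α⁻¹ * β⁻¹ with hγ
  have hγα : γ * (β * α * β⁻¹) = α := by rw [hγ]; group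
  have hcommA : Commute (linPart α) (linPart γ) := by
    rwa [map_mul linPart α γ, map_mul linPart γ α] at h
  have hcomm : Commute (linPart γ) (linPart (β * α * β⁻¹)) := by
    have h1 : linPart (β * α * β⁻¹) = linPart γ⁻¹ * linPart α := by
      rw [← map_mul]; congr 1; rw [hγ]; group
    rw [h1]
    refine Commute.mul_right ?_ hcommA.symm
    rw [Commute, SemiconjBy, linPart_mul_inv, linPart_inv_mul]
  apply linPart_eq_one_of_pow
  intro n
  have h1 : linPart (γ ^ n) = linPart (α ^ n * β * (α ^ n)⁻¹ * β⁻¹) := by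
    have h2 : linPart (α ^ n) = linPart (γ ^ n) * linPart (β * α ^ n * β⁻¹) := by
      rw [← conj_pow, map_pow, map_pow, map_pow, ← hcomm.mul_pow, ← map_mul, hγα]
    rw [show α ^ n * β * (α ^ n)⁻¹ * β⁻¹ = α ^ n * (β * (α ^ n)⁻¹ * β⁻¹) by group, map_mul, h2,
      mul_assoc, ← map_mul, show β * α ^ n * β⁻¹ * (β * (α ^ n)⁻¹ * β⁻¹) = 1 by group, map_one,
      mul_one]
  rw [h1]
  have h3 : linPart (α ^ n * β * (α ^ n)⁻¹ * β⁻¹) - 1 =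
      linPart (α ^ n) * ((linPart β - 1) * linPart ((α ^ n)⁻¹ * β⁻¹)) -
        (linPart β - 1) * linPart β⁻¹ := by
    rw [show α ^ n * β * (α ^ n)⁻¹ * β⁻¹ = α ^ n * (β * ((α ^ n)⁻¹ * β⁻¹)) by group]
    rw [sub_mul, sub_mul, mul_sub, linPart_mul_inv, one_mul, one_mul, ← map_mul, ← map_mul,
      ← map_mul, show α ^ n * ((α ^ n)⁻¹ * β⁻¹) = β⁻¹ by group]
    abel
  rw [h3]
  refine (norm_sub_le _ _).trans ?_
  have h4 := (norm_linPart_mul_le ((linPart β - 1) * linPart ((α ^ n)⁻¹ * β⁻¹)) (α ^ n)).trans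
    (norm_mul_linPart_le _ _)
  have h5 := norm_mul_linPart_le (linPart β - 1) β⁻¹
  linarith

/-- The translation part of a commutator. -/
lemma comm_apply_zero (α β : X ≃ᵢ X) :
    (α * β * α⁻¹ * β⁻¹) 0 = (linPart α (β 0) - β 0) -
      (linPart (α * β * α⁻¹ * β⁻¹) (β 0) - β 0) -
      (linPart (α * β * α⁻¹ * β⁻¹) (linPart β (α 0)) - linPart β (α 0)) -
      (linPart β (α 0) - α 0) := by
  set γ := α * β * α⁻¹ * β⁻¹ with hγ
  have h1 : γ * (β * α) = α * β := by rw [hγ]; group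
  have h2 : γ (β (α 0)) = α (β 0) := DFunLike.congr_fun h1 0
  rw [apply_eq_linPart γ, apply_eq_linPart β (α 0), map_add, apply_eq_linPart α (β 0)] at h2
  have h3 : γ 0 = linPart α (β 0) + α 0 - (linPart γ (linPart β (α 0)) + linPart γ (β 0)) := by
    rw [← h2]; abel
  rw [h3]
  abel

lemma norm_linPart_iterComm_le {α β : X ≃ᵢ X} (hα : ‖linPart α - 1‖ ≤ 1 / 4)
    (hβ : ‖linPart β - 1‖ ≤ 1 / 4) (k : ℕ) :
    ‖linPart (iterComm α β k) - 1‖ ≤ 1 / 4 * (1 / 2) ^ k := by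
  induction k with
  | zero => simpa [iterComm] using hβ
  | succ k ih =>
    have h := norm_linPart_comm_sub_one_le α (iterComm α β k)
    rw [iterComm, pow_succ]
    nlinarith [norm_nonneg (linPart (iterComm α β k) - 1)]

lemma norm_iterComm_zero_le {α β : X ≃ᵢ X} (hα : ‖linPart α - 1‖ ≤ 1 / 4)
    (hβ : ‖linPart β - 1‖ ≤ 1 / 4) (k : ℕ) :
    ‖iterComm α β k 0‖ ≤ (‖β 0‖ + 3 * ‖α 0‖) * (1 / 2) ^ k := by
  have bd : ∀ (T : X →L[ℝ] X) (x : X), ‖T x - x‖ ≤ ‖T - 1‖ * ‖x‖ := fun T x ↦ by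
    simpa using (T - 1).le_opNorm x
  induction k with
  | zero => simp [iterComm]
  | succ k ih =>
    have e0 := norm_linPart_iterComm_le hα hβ k
    have e1 := norm_linPart_iterComm_le hα hβ (k + 1)
    have hb := comm_apply_zero α (iterComm α β k)
    rw [iterComm] at e1 ⊢
    set γ := iterComm α β k with hγ
    rw [hb]
    have h1 := bd (linPart α) (γ 0)
    have h2 := bd (linPart (α * γ * α⁻¹ * γ⁻¹)) (γ 0)
    have h3 := bd (linPart (α * γ * α⁻¹ * γ⁻¹)) (linPart γ (α 0))
    have h4 := bd (linPart γ) (α 0)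
    rw [norm_linPart_apply] at h3
    have h5 := (norm_sub_le (linPart α (γ 0) - γ 0 -
      (linPart (α * γ * α⁻¹ * γ⁻¹) (γ 0) - γ 0) -
      (linPart (α * γ * α⁻¹ * γ⁻¹) (linPart γ (α 0)) - linPart γ (α 0)))
      (linPart γ (α 0) - α 0))
    have h6 := norm_sub_le (linPart α (γ 0) - γ 0 -
      (linPart (α * γ * α⁻¹ * γ⁻¹) (γ 0) - γ 0))
      (linPart (α * γ * α⁻¹ * γ⁻¹) (linPart γ (α 0)) - linPart γ (α 0))
    have h7 := norm_sub_le (linPart α (γ 0) - γ 0) (linPart (α * γ * α⁻¹ * γ⁻¹) (γ 0) - γ 0)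
    have hp : (1 / 2 : ℝ) ^ k ≤ 1 := pow_le_one₀ (by norm_num) (by norm_num)
    have hp0 : (0 : ℝ) < (1 / 2) ^ k := by positivity
    rw [pow_succ] at e1 ⊢
    have n1 := norm_nonneg (γ 0)
    have n2 := norm_nonneg (α 0)
    have i1 : ‖linPart α - 1‖ * ‖γ 0‖ ≤ 1 / 4 * ‖γ 0‖ := by gcongr
    have i2 : ‖linPart (α * γ * α⁻¹ * γ⁻¹) - 1‖ * ‖γ 0‖ ≤ 1 / 8 * ‖γ 0‖ := by
      gcongr; linarith
    have i3 := mul_le_mul_of_nonneg_right e1 n2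
    have i4 := mul_le_mul_of_nonneg_right e0 n2
    have n3 := norm_nonneg (β 0)
    nlinarith [mul_nonneg n3 hp0.le, mul_nonneg n2 hp0.le]

lemma IsSpaceGroup.finite_norm_le [FiniteDimensional ℝ X] {M : Subgroup (X ≃ᵢ X)}
    (hM : IsSpaceGroup M) (R : ℝ) : {γ : X ≃ᵢ X | γ ∈ M ∧ ‖γ 0‖ ≤ R}.Finite := by
  refine (hM.1 (Metric.closedBall 0 R) (isCompact_closedBall 0 R)).subset ?_
  rintro γ ⟨hγ, h⟩
  refine ⟨hγ, γ 0, ⟨0, ?_, rfl⟩, by simpa using h⟩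
  simpa using (norm_nonneg _).trans h

/-- In every direction, a space group contains an isometry with almost trivial linear part
moving the origin far in almost that direction. -/
lemma IsSpaceGroup.exists_direction [FiniteDimensional ℝ X] {M : Subgroup (X ≃ᵢ X)}
    (hM : IsSpaceGroup M) (u : X) {ε : ℝ} (hε : 0 < ε) :
    ∃ β ∈ M, ∃ s : ℝ, 1 ≤ s ∧ ‖linPart β - 1‖ ≤ ε ∧ ‖β 0 - s • u‖ ≤ ε * s := by
  obtain ⟨R, hR, hnear⟩ := hM.exists_near
  choose γ hγM hγ using fun k : ℕ ↦ hnear ((k : ℝ) • u)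
  obtain ⟨A, -, φ, hφ, hA⟩ := tendsto_subseq_of_bounded
    (Metric.isBounded_closedBall (x := (0 : X →L[ℝ] X)) (r := 1))
    (x := fun k ↦ linPart (γ k)) (fun k ↦ by simpa using norm_linPart_le (γ k))
  obtain ⟨N, hN⟩ := Metric.cauchySeq_iff'.1 hA.cauchySeq ε hε
  set i := φ N with hi
  obtain ⟨n, hn⟩ := exists_nat_ge (max 1 ((2 * R + ε * ‖γ i 0‖) / ε) + i)
  set p := max n N with hp
  have hpn : (n : ℝ) ≤ φ p := by exact_mod_cast (le_max_left n N).trans (hφ.id_le p)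
  have hs : max 1 ((2 * R + ε * ‖γ i 0‖) / ε) ≤ (φ p : ℝ) - i := by linarith
  have hlin : ‖linPart (γ (φ p) * (γ i)⁻¹) - 1‖ ≤ ε := by
    rw [map_mul, ← linPart_mul_inv (γ i), ← sub_mul]
    refine (norm_mul_linPart_le _ _).trans ?_
    have := hN p (le_max_right _ _)
    rw [dist_eq_norm] at this
    exact this.le
  refine ⟨γ (φ p) * (γ i)⁻¹, M.mul_mem (hγM _) (M.inv_mem (hγM _)), φ p - i,
    (le_max_left _ _).trans hs, hlin, ?_⟩
  set β := γ (φ p) * (γ i)⁻¹ with hβ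
  have h1 : β (γ i 0) = γ (φ p) 0 := by
    have : β * γ i = γ (φ p) := by rw [hβ]; group
    exact DFunLike.congr_fun this 0
  rw [apply_eq_linPart] at h1
  have h2 : β 0 - ((φ p : ℝ) - i) • u = (γ (φ p) 0 - (φ p : ℝ) • u) - (γ i 0 - (i : ℝ) • u) -
      (linPart β - 1) (γ i 0) := by
    rw [← h1, sub_smul]
    simp only [sub_apply, one_apply_eq_self]
    abel
  rw [h2]
  have h3 := norm_sub_le (γ (φ p) 0 - (φ p : ℝ) • u - (γ i 0 - (i : ℝ) • u))
    ((linPart β - 1) (γ i 0))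
  have h4 := norm_sub_le (γ (φ p) 0 - (φ p : ℝ) • u) (γ i 0 - (i : ℝ) • u)
  have h5 := (linPart β - 1).le_of_opNorm_le hlin (γ i 0)
  have h6 := hγ (φ p)
  have h7 := hγ i
  have h8 := (le_max_right _ _).trans hs
  rw [div_le_iff₀ hε] at h8
  linarith

lemma linPart_sub_one_sq_eq_zero {α : X ≃ᵢ X} {x : X}
    (h : (linPart α - 1) ((linPart α - 1) x) = 0) : (linPart α - 1) x = 0 := by
  set y := (linPart α - 1) x with hy
  have hy1 : linPart α y = y := by simpa [sub_eq_zero] using h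
  have hx : linPart α x = x + y := by rw [hy]; simp
  have h1 : inner ℝ (linPart α x) (linPart α y) = inner ℝ x y :=
    α.toRealLinearIsometryEquiv.inner_map_map x y
  rw [hx, hy1, inner_add_left] at h1
  exact inner_self_eq_zero (𝕜 := ℝ).1 (by linarith)

/-- **Bieberbach**: an element of a space group whose linear part is close to the identity is a
translation. -/
lemma IsSpaceGroup.linPart_eq_one [FiniteDimensional ℝ X] {M : Subgroup (X ≃ᵢ X)}
    (hM : IsSpaceGroup M) {α : X ≃ᵢ X} (hαM : α ∈ M) (hα : ‖linPart α - 1‖ ≤ 1 / 4) :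
    linPart α = 1 := by
  by_contra hne
  obtain ⟨u, hu⟩ : ∃ u, (linPart α - 1) ((linPart α - 1) u) ≠ 0 := by
    by_contra! hall
    apply hne
    rw [← sub_eq_zero]
    ext u
    exact linPart_sub_one_sq_eq_zero (hall u)
  set w := (linPart α - 1) ((linPart α - 1) u) with hw
  have hwpos : 0 < ‖w‖ := norm_pos_iff.2 hu
  obtain ⟨β, hβM, s, hs, hβ, hβu⟩ := hM.exists_direction u
    (ε := min (1 / 4) (‖w‖ / (3 * (‖α 0‖ + 1)))) (by positivity)
  have hβ4 : ‖linPart β - 1‖ ≤ 1 / 4 := hβ.trans (min_le_left _ _)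
  have hε : min (1 / 4) (‖w‖ / (3 * (‖α 0‖ + 1))) * (3 * (‖α 0‖ + 1)) ≤ ‖w‖ := by
    rw [← le_div_iff₀ (by positivity)]
    exact min_le_right _ _
  set ε := min (1 / 4) (‖w‖ / (3 * (‖α 0‖ + 1))) with hεdef
  have hε0 : 0 < ε := by positivity
  -- the iterated commutators are eventually trivial
  obtain ⟨K, hK⟩ : ∃ K, iterComm α β K = 1 := by
    set C := ‖β 0‖ + 3 * ‖α 0‖ with hC
    have hC0 : 0 ≤ C := by positivity
    have hfin : {γ : X ≃ᵢ X | (γ ∈ M ∧ ‖γ 0‖ ≤ C) ∧ γ ≠ 1}.Finite :=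
      (hM.finite_norm_le C).subset fun γ h ↦ h.1
    have hlow : ∃ c > 0, ∀ γ ∈ {γ : X ≃ᵢ X | (γ ∈ M ∧ ‖γ 0‖ ≤ C) ∧ γ ≠ 1},
        c ≤ ‖linPart γ - 1‖ + ‖γ 0‖ := by
      rcases Set.eq_empty_or_nonempty {γ : X ≃ᵢ X | (γ ∈ M ∧ ‖γ 0‖ ≤ C) ∧ γ ≠ 1} with h | h
      · exact ⟨1, one_pos, by simp [h]⟩
      · obtain ⟨γ, hγ, hmin⟩ := Set.exists_min_image _
          (fun γ ↦ ‖linPart γ - 1‖ + ‖γ 0‖) hfin h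
        refine ⟨_, ?_, hmin⟩
        by_contra! hle
        have n1 := norm_nonneg (linPart γ - 1)
        have n2 := norm_nonneg (γ 0)
        exact hγ.2 (eq_one_of_linPart_eq_one (sub_eq_zero.1 (norm_eq_zero.1 (by linarith)))
          (norm_eq_zero.1 (by linarith)))
    obtain ⟨c, hc, hlow⟩ := hlow
    obtain ⟨K, hK⟩ := exists_pow_lt_of_lt_one (show 0 < c / (1 + C) by positivity)
      (show (1 / 2 : ℝ) < 1 by norm_num)
    refine ⟨K, ?_⟩
    by_contra hne1
    have h1 := norm_linPart_iterComm_le hα hβ4 K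
    have h2 := norm_iterComm_zero_le hα hβ4 K
    rw [← hC] at h2
    have hp : (1 / 2 : ℝ) ^ K ≤ 1 := pow_le_one₀ (by norm_num) (by norm_num)
    have hp0 : (0 : ℝ) < (1 / 2) ^ K := by positivity
    have h3 := hlow (iterComm α β K) ⟨⟨iterComm_mem hαM hβM K, h2.trans (by nlinarith)⟩, hne1⟩
    rw [lt_div_iff₀ (by positivity)] at hK
    nlinarith
  -- going down, all commutators are translations
  have hdown : ∀ k, linPart (iterComm α β (k + 1)) = 1 → linPart (α * iterComm α β k) =
      linPart (iterComm α β k * α) := by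
    intro k hk
    have : α * iterComm α β k = iterComm α β (k + 1) * (iterComm α β k * α) := by
      rw [iterComm]; group
    rw [this, map_mul, hk, one_mul]
  have hall : ∀ j, ∀ k, k + j = K → linPart (iterComm α β (k + 1)) = 1 := by
    intro j
    induction j with
    | zero =>
      rintro k rfl
      rw [iterComm, show iterComm α β k = 1 from hK]
      simp
    | succ j ih =>
      intro k hk
      have h1 := ih (k + 1) (by omega)
      have h2 := hdown (k + 1) h1
      have h3 := norm_linPart_iterComm_le hα hβ4 k
      refine linPart_comm_eq_one α (iterComm α β k) (h3.trans ?_) h2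
      have hp : (1 / 2 : ℝ) ^ k ≤ 1 := pow_le_one₀ (by norm_num) (by norm_num)
      linarith
  have hall1 : ∀ k, linPart (iterComm α β (k + 1)) = 1 := by
    intro k
    rcases le_total k K with h | h
    · exact hall (K - k) k (by omega)
    · obtain ⟨d, rfl⟩ := Nat.exists_eq_add_of_le h
      have : ∀ d, iterComm α β (K + d) = 1 := fun d ↦ by
        induction d with
        | zero => exact hK
        | succ d ih => rw [← add_assoc, iterComm, ih]; simp
      rw [add_assoc, this, map_one]
  have hstep : ∀ k, iterComm α β (k + 2) 0 = (linPart α - 1) (iterComm α β (k + 1) 0) := by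
    intro k
    have h := comm_apply_zero α (iterComm α β (k + 1))
    have h1 := hall1 (k + 1)
    rw [iterComm] at h1
    rw [iterComm, h, h1, hall1 k]
    simp
  have hfirst : iterComm α β 1 0 = (linPart α - 1) (β 0) - (linPart β - 1) (α 0) := by
    have h := comm_apply_zero α β
    have h1 := hall1 0
    simp only [iterComm] at h1 ⊢
    rw [h, h1]
    simp
  have hker : ∀ j k, k + j = K → (linPart α - 1) (iterComm α β (k + 1) 0) = 0 := by
    intro j
    induction j with
    | zero =>
      rintro k rfl
      rw [← hstep, iterComm, iterComm, show iterComm α β k = 1 from hK]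
      simp
    | succ j ih =>
      intro k hk
      have h1 := ih (k + 1) (by omega)
      rw [hstep] at h1
      exact linPart_sub_one_sq_eq_zero h1
  have hmain := hker K 0 (by omega)
  rw [zero_add, hfirst, map_sub, sub_eq_zero] at hmain
  have hA1 : ∀ x, ‖(linPart α - 1) x‖ ≤ ‖x‖ := fun x ↦ by
    have := (linPart α - 1).le_of_opNorm_le hα x
    linarith [norm_nonneg x]
  have h1 : s • w = (linPart α - 1) ((linPart α - 1) (β 0)) -
      (linPart α - 1) ((linPart α - 1) (β 0 - s • u)) := by
    rw [hw]; simp only [map_sub, map_smul]; abel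
  have h2 : ‖s • w‖ ≤ ε * ‖α 0‖ + ε * s := by
    rw [h1]
    refine (norm_sub_le _ _).trans (add_le_add ?_ ?_)
    · rw [hmain]
      exact (hA1 _).trans ((linPart β - 1).le_of_opNorm_le hβ _)
    · exact (hA1 _).trans ((hA1 _).trans hβu)
  rw [norm_smul, Real.norm_eq_abs, abs_of_pos (by linarith)] at h2
  have n2 := norm_nonneg (α 0)
  have h3 : ε * ‖α 0‖ ≤ ε * ‖α 0‖ * s := le_mul_of_one_le_right (by positivity) hs
  nlinarith [mul_pos hε0 (by linarith : 0 < s)]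

end Geometry

section Lattice

/-- A space group on a connected space is finitely generated. -/
lemma IsSpaceGroup.group_fg {X : Type*} [MetricSpace X] [ProperSpace X] [ConnectedSpace X]
    {Γ : Subgroup (X ≃ᵢ X)} (hΓ : IsSpaceGroup Γ) : Group.FG Γ := by
  obtain ⟨K, hK, hcov⟩ := hΓ.2
  obtain ⟨x₀⟩ := (inferInstance : Nonempty X)
  obtain ⟨r, hr⟩ := hK.isBounded.subset_ball x₀
  set U := Metric.ball x₀ (max r 1) with hU
  have hKU : K ⊆ U := hr.trans (Metric.ball_subset_ball (le_max_left _ _))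
  have hfin := hΓ.1 (Metric.closedBall x₀ (max r 1)) (isCompact_closedBall _ _)
  set A := {γ : X ≃ᵢ X | γ ∈ Γ ∧ ((γ : X → X) '' Metric.closedBall x₀ (max r 1) ∩
    Metric.closedBall x₀ (max r 1)).Nonempty} with hA
  have hAmem : ∀ γ ∈ Γ, ∀ x ∈ U, γ x ∈ U → γ ∈ A := fun γ hγ x hx hγx ↦
    ⟨hγ, γ x, ⟨x, Metric.ball_subset_closedBall hx, rfl⟩, Metric.ball_subset_closedBall hγx⟩
  have hle : Subgroup.closure A ≤ Γ := (Subgroup.closure_le _).2 fun γ hγ ↦ hγ.1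
  set Y := ⋃ γ ∈ Subgroup.closure A, (γ : X → X) '' U with hY
  have hYo : IsOpen Y := isOpen_biUnion fun γ _ ↦ γ.toHomeomorph.isOpenMap _ Metric.isOpen_ball
  have hYc : IsOpen Yᶜ := by
    rw [isOpen_iff_forall_mem_open]
    intro x hx
    obtain ⟨γ, hγ, hγx⟩ := hcov x
    refine ⟨(γ : X → X) ⁻¹' U, ?_, γ.continuous.isOpen_preimage _ Metric.isOpen_ball, hKU hγx⟩
    intro y hy hyY
    apply hx
    simp only [hY, Set.mem_iUnion] at hyY ⊢
    obtain ⟨δ, hδ, z, hz, rfl⟩ := hyY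
    have h1 : γ * δ ∈ Subgroup.closure A :=
      Subgroup.subset_closure (hAmem _ (Γ.mul_mem hγ (hle hδ)) z hz hy)
    have h2 : γ ∈ Subgroup.closure A := by
      simpa using (Subgroup.closure A).mul_mem h1 ((Subgroup.closure A).inv_mem hδ)
    exact ⟨γ⁻¹, (Subgroup.closure A).inv_mem h2, γ x, hKU hγx,
      DFunLike.congr_fun (inv_mul_cancel γ) x⟩
  have hx₀ : x₀ ∈ U := Metric.mem_ball_self (by positivity)
  have hYuniv : Y = Set.univ := IsClopen.eq_univ ⟨⟨hYc⟩, hYo⟩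
    ⟨x₀, Set.mem_biUnion (Subgroup.one_mem _) ⟨x₀, hx₀, rfl⟩⟩
  have hclosure : Subgroup.closure A = Γ := by
    refine le_antisymm hle fun γ hγ ↦ ?_
    have h1 : γ x₀ ∈ Y := hYuniv ▸ Set.mem_univ _
    simp only [hY, Set.mem_iUnion] at h1
    obtain ⟨δ, hδ, z, hz, h2⟩ := h1
    have h3 : δ⁻¹ * γ ∈ Subgroup.closure A := by
      refine Subgroup.subset_closure (hAmem _ (Γ.mul_mem (Γ.inv_mem (hle hδ)) hγ) x₀ hx₀ ?_)
      rw [show (δ⁻¹ * γ) x₀ = δ⁻¹ (γ x₀) from rfl, ← h2,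
        show δ⁻¹ (δ z) = z from DFunLike.congr_fun (inv_mul_cancel δ) z]
      exact hz
    simpa using (Subgroup.closure A).mul_mem hδ h3
  rw [Group.fg_iff_subgroup_fg, Subgroup.fg_iff]
  exact ⟨A, hclosure, hfin⟩

variable {X : Type*} [NormedAddCommGroup X] [InnerProductSpace ℝ X]

/-- The subgroup of translations of a group of isometries. -/
def translations (M : Subgroup (X ≃ᵢ X)) : Subgroup M := (linPart.comp M.subtype).ker

lemma mem_translations {M : Subgroup (X ≃ᵢ X)} {γ : M} :
    γ ∈ translations M ↔ linPart (γ : X ≃ᵢ X) = 1 := Iff.rfl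

instance (M : Subgroup (X ≃ᵢ X)) : (translations M).Normal := by
  unfold translations; infer_instance

lemma translations_apply {M : Subgroup (X ≃ᵢ X)} {γ : M} (h : γ ∈ translations M) (x : X) :
    (γ : X ≃ᵢ X) x = x + (γ : X ≃ᵢ X) 0 := by
  rw [apply_eq_linPart, mem_translations.1 h, one_apply_eq_self]

lemma translations_comm {M : Subgroup (X ≃ᵢ X)} {s t : M} (hs : s ∈ translations M)
    (ht : t ∈ translations M) : s * t = t * s := by
  ext x
  simp only [Subgroup.coe_mul, IsometryEquiv.mul_apply]
  rw [translations_apply hs ((t : X ≃ᵢ X) x), translations_apply hs x, translations_apply ht x,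
    translations_apply ht (x + _)]
  abel

lemma translations_pow_eq_one {M : Subgroup (X ≃ᵢ X)} {t : M} (ht : t ∈ translations M) {n : ℕ}
    (hn : n ≠ 0) (h : t ^ n = 1) : t = 1 := by
  have h1 : ∀ k : ℕ, ((t : X ≃ᵢ X) ^ k) 0 = (k : ℝ) • (t : X ≃ᵢ X) 0 := by
    intro k
    induction k with
    | zero => simp
    | succ k ih =>
      rw [pow_succ', IsometryEquiv.mul_apply, ih, translations_apply ht, Nat.cast_succ, add_smul,
        one_smul]
  have h2 := h1 n
  rw [← Subgroup.coe_pow, h] at h2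
  have h3 : (t : X ≃ᵢ X) 0 = 0 := by
    have h4 := h2.symm
    simpa [hn] using h4
  exact Subtype.ext (eq_one_of_linPart_eq_one ht h3)

variable [FiniteDimensional ℝ X]

lemma IsSpaceGroup.finiteIndex_translations {M : Subgroup (X ≃ᵢ X)} (hM : IsSpaceGroup M) :
    (translations M).FiniteIndex := by
  have hfin : (Set.range fun γ : M ↦ linPart (γ : X ≃ᵢ X)).Finite := by
    by_contra hinf
    have hinf : (Set.range fun γ : M ↦ linPart (γ : X ≃ᵢ X)).Infinite := hinf
    set f := hinf.natEmbedding
    obtain ⟨A, -, φ, hφ, hA⟩ := tendsto_subseq_of_bounded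
      (Metric.isBounded_closedBall (x := (0 : X →L[ℝ] X)) (r := 1))
      (x := fun k ↦ (f k : X →L[ℝ] X)) (fun k ↦ by
        obtain ⟨γ, hγ⟩ := (f k).2
        simpa [← hγ] using norm_linPart_le (γ : X ≃ᵢ X))
    obtain ⟨N, hN⟩ := Metric.cauchySeq_iff'.1 hA.cauchySeq (1 / 4) (by norm_num)
    have h1 := hN (N + 1) (Nat.le_succ N)
    obtain ⟨γ, hγ⟩ := (f (φ N)).2
    obtain ⟨δ, hδ⟩ := (f (φ (N + 1))).2
    simp only [Function.comp, ← hγ, ← hδ, dist_eq_norm] at h1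
    have h2 : ‖linPart ((δ : X ≃ᵢ X) * (γ : X ≃ᵢ X)⁻¹) - 1‖ ≤ 1 / 4 := by
      rw [map_mul, ← linPart_mul_inv (γ : X ≃ᵢ X), ← sub_mul]
      exact (norm_mul_linPart_le _ _).trans h1.le
    have h3 := hM.linPart_eq_one (M.mul_mem δ.2 (M.inv_mem γ.2)) h2
    have h4 : linPart (δ : X ≃ᵢ X) = linPart (γ : X ≃ᵢ X) := by
      rw [← one_mul (linPart (γ : X ≃ᵢ X)), ← h3, ← map_mul, inv_mul_cancel_right]
    have h5 : f (φ (N + 1)) = f (φ N) := Subtype.ext (by rw [← hγ, ← hδ]; exact h4)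
    have h6 := hφ.injective (f.injective h5)
    omega
  have := hfin.to_subtype
  have hq : Finite (M ⧸ translations M) := by
    refine Finite.of_injective (β := Set.range fun γ : M ↦ linPart (γ : X ≃ᵢ X))
      (fun q ↦ ⟨linPart (q.out : X ≃ᵢ X), q.out, rfl⟩) fun p q h ↦ ?_
    have h1 : linPart ((p.out : M) : X ≃ᵢ X) = linPart ((q.out : M) : X ≃ᵢ X) :=
      congrArg Subtype.val h
    have h2 : (QuotientGroup.mk p.out : M ⧸ translations M) = QuotientGroup.mk q.out := by
      rw [QuotientGroup.eq, mem_translations, Subgroup.coe_mul, map_mul, ← h1, Subgroup.coe_inv,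
        linPart_inv_mul]
    rwa [QuotientGroup.out_eq', QuotientGroup.out_eq'] at h2
  exact Subgroup.finiteIndex_of_finite_quotient

/-- The translation subgroup of a space group is self-centralizing. -/
lemma IsSpaceGroup.mem_translations_of_commute {M : Subgroup (X ≃ᵢ X)} (hM : IsSpaceGroup M)
    {γ : M} (h : ∀ t ∈ translations M, γ * t = t * γ) : γ ∈ translations M := by
  have := hM.finiteIndex_translations
  obtain ⟨R, hR, hnear⟩ := hM.exists_near
  have hfix : ∀ t ∈ translations M, linPart (γ : X ≃ᵢ X) ((t : X ≃ᵢ X) 0) = (t : X ≃ᵢ X) 0 := by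
    intro t ht
    have h1 : (γ : X ≃ᵢ X) ((t : X ≃ᵢ X) 0) = (t : X ≃ᵢ X) ((γ : X ≃ᵢ X) 0) :=
      DFunLike.congr_fun (congrArg Subtype.val (h t ht)) 0
    rw [translations_apply ht ((γ : X ≃ᵢ X) 0), apply_eq_linPart (γ : X ≃ᵢ X), add_comm] at h1
    exact add_left_cancel h1
  obtain ⟨C, hC⟩ : ∃ C : ℝ, ∀ q : M ⧸ translations M, ‖((q.out : M) : X ≃ᵢ X) 0‖ ≤ C := by
    obtain ⟨C, hC⟩ := (Set.finite_range
      fun q : M ⧸ translations M ↦ ‖((q.out : M) : X ≃ᵢ X) 0‖).bddAbove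
    exact ⟨C, fun q ↦ hC ⟨q, rfl⟩⟩
  have hbd : ∀ x, ‖(linPart (γ : X ≃ᵢ X) - 1) x‖ ≤ 2 * (R + C) := by
    intro x
    obtain ⟨δ, hδ, hx⟩ := hnear x
    set q : M ⧸ translations M := QuotientGroup.mk ⟨δ, hδ⟩ with hq
    have h1 : (⟨δ, hδ⟩ : M) * (q.out)⁻¹ ∈ translations M := by
      apply (inferInstance : (translations M).Normal).mem_comm
      rw [← QuotientGroup.eq, QuotientGroup.out_eq']
    set t := (⟨δ, hδ⟩ : M) * (q.out)⁻¹ with ht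
    have h2 : (δ : X ≃ᵢ X) 0 = ((q.out : M) : X ≃ᵢ X) 0 + (t : X ≃ᵢ X) 0 := by
      rw [← translations_apply h1]
      have : δ = (t : X ≃ᵢ X) * ((q.out : M) : X ≃ᵢ X) := by
        rw [ht]; simp
      conv_lhs => rw [this]
      rfl
    have h3 : (linPart (γ : X ≃ᵢ X) - 1) x =
        (linPart (γ : X ≃ᵢ X) - 1) (((q.out : M) : X ≃ᵢ X) 0 - (δ 0 - x)) := by
      have h4 : ((q.out : M) : X ≃ᵢ X) 0 - (δ 0 - x) = x - (t : X ≃ᵢ X) 0 := by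
        rw [h2]; abel
      have h5 : (linPart (γ : X ≃ᵢ X) - 1) ((t : X ≃ᵢ X) 0) = 0 := by
        simp [hfix t h1]
      rw [h4, map_sub, h5, sub_zero]
    rw [h3]
    have h6 : ∀ y, ‖(linPart (γ : X ≃ᵢ X) - 1) y‖ ≤ 2 * ‖y‖ := fun y ↦ by
      have := norm_sub_le (linPart (γ : X ≃ᵢ X) y) y
      rw [norm_linPart_apply] at this
      simp only [sub_apply, one_apply_eq_self]
      linarith
    have h7 := norm_sub_le (((q.out : M) : X ≃ᵢ X) 0) (δ 0 - x)
    have h8 := hC q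
    have h9 := h6 (((q.out : M) : X ≃ᵢ X) 0 - (δ 0 - x))
    linarith
  rw [mem_translations, ← sub_eq_zero]
  ext x
  by_contra hne
  have hpos : 0 < ‖(linPart (γ : X ≃ᵢ X) - 1) x‖ := norm_pos_iff.2 hne
  obtain ⟨n, hn⟩ := exists_nat_gt (2 * (R + C) / ‖(linPart (γ : X ≃ᵢ X) - 1) x‖)
  rw [div_lt_iff₀ hpos] at hn
  have h1 := hbd ((n : ℝ) • x)
  rw [map_smul, norm_smul, Real.norm_natCast] at h1
  linarith

end Lattice

section Algebra

/-- The group `G` has a finite subset containing a conjugate of every finite subgroup. -/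
def HasFiniteConjSet (G : Type*) [Group G] : Prop :=
  ∃ S : Set G, S.Finite ∧ ∀ F : Subgroup G, Finite F → ∃ g : G, ∀ f ∈ F, g * f * g⁻¹ ∈ S

lemma HasFiniteConjSet.of_mulEquiv {G H : Type*} [Group G] [Group H] (e : G ≃* H)
    (h : HasFiniteConjSet G) : HasFiniteConjSet H := by
  obtain ⟨S, hS, h⟩ := h
  refine ⟨e '' S, hS.image e, fun F hF ↦ ?_⟩
  have : Finite (F.map (e.symm : H →* G)) :=
    Set.Finite.subset (Set.Finite.image e.symm F.carrier.toFinite) fun x hx ↦ hx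
  obtain ⟨g, hg⟩ := h (F.map (e.symm : H →* G)) this
  refine ⟨e g, fun f hf ↦ ⟨_, hg (e.symm f) ⟨f, hf, rfl⟩, ?_⟩⟩
  simp

/-- A map to a finite type has finitely many elements representing all values on a set. -/
lemma exists_finite_representatives {A B : Type*} [Finite B] (p : Set A) (c : A → B) :
    ∃ R : Set A, R.Finite ∧ R ⊆ p ∧ ∀ a ∈ p, ∃ r ∈ R, c r = c a := by
  obtain ⟨R, hRp, hR⟩ := Set.exists_subset_bijOn p c
  refine ⟨R, ?_, hRp, fun a ha ↦ ?_⟩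
  · exact Set.Finite.of_finite_image (hR.image_eq ▸ Set.toFinite _) hR.injOn
  · exact hR.surjOn ⟨a, ha, rfl⟩

/-- Conjugation by an element normalizing an embedded group restricts to an automorphism. -/
lemma exists_mulAut_of_conj {M K : Type*} [Group M] [Group K] (i : M →* K)
    (hi : Function.Injective i) (k : K) (h₁ : ∀ x, ∃ y, i y = k * i x * k⁻¹)
    (h₂ : ∀ x, ∃ y, i y = k⁻¹ * i x * k) :
    ∃ φ : MulAut M, ∀ x, i (φ x) = k * i x * k⁻¹ := by
  choose f hf using h₁
  choose f' hf' using h₂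
  refine ⟨⟨⟨f, f', fun x ↦ hi ?_, fun x ↦ hi ?_⟩, fun x y ↦ hi ?_⟩, hf⟩
  · rw [hf', hf]; group
  · rw [hf, hf']; group
  · rw [hf, map_mul, map_mul, hf, hf]; group

open scoped IsMulCommutative

variable {M : Type*} [Group M] {T : Subgroup M} [T.Normal]

lemma conjNormal_eq_one_of_mem [IsMulCommutative T] {t : M} (ht : t ∈ T) :
    MulAut.conjNormal (H := T) t = 1 := by
  ext s
  rw [MulAut.conjNormal_apply, MulAut.one_apply]
  have h : (⟨t, ht⟩ : T) * s = s * ⟨t, ht⟩ := mul_comm _ _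
  have h' : t * (s : M) = s * t := congrArg Subtype.val h
  rw [h', mul_inv_cancel_right]

lemma characteristic_of_self_centralizing [IsMulCommutative T] [IsMulTorsionFree T]
    [T.FiniteIndex] (hself : ∀ γ, (∀ t ∈ T, γ * t = t * γ) → γ ∈ T) : T.Characteristic := by
  rw [Subgroup.characteristic_iff_map_le]
  rintro φ _ ⟨t, ht, rfl⟩
  apply hself
  intro s hs
  have hT' : (T.map φ.toMonoidHom).FiniteIndex := by
    refine ⟨?_⟩
    have h : (T.map φ.toMonoidHom).index = T.index := Subgroup.index_map_equiv T φ
    rw [h]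
    exact Subgroup.FiniteIndex.index_ne_zero
  obtain ⟨n, hn, hsn⟩ : ∃ n : ℕ, n ≠ 0 ∧ s ^ n ∈ T.map φ.toMonoidHom := by
    obtain ⟨n, hn, -, h⟩ := Subgroup.exists_pow_mem_of_index_ne_zero hT'.index_ne_zero s
    exact ⟨n, by omega, h⟩
  obtain ⟨r, hr, hrs⟩ := hsn
  have h1 : φ t * s ^ n = s ^ n * φ t := by
    rw [← hrs]
    have h : (⟨t, ht⟩ : T) * ⟨r, hr⟩ = ⟨r, hr⟩ * ⟨t, ht⟩ := mul_comm _ _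
    have h' : t * r = r * t := congrArg Subtype.val h
    have := congrArg φ h'
    simpa using this
  have h2 : MulAut.conjNormal (H := T) (φ t) ⟨s, hs⟩ = ⟨s, hs⟩ := by
    apply pow_left_injective hn
    ext
    simp only [← map_pow, MulAut.conjNormal_apply, Subgroup.coe_pow]
    rw [h1, mul_inv_cancel_right]
  have h3 := congrArg Subtype.val h2
  rw [MulAut.conjNormal_apply] at h3
  exact mul_inv_eq_iff_eq_mul.1 h3

lemma mul_out_mem (γ : M) (q : M ⧸ T) : γ * q.out * (γ • q).out⁻¹ ∈ T := by
  apply (inferInstance : T.Normal).mem_comm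
  rw [← QuotientGroup.eq, QuotientGroup.out_eq', ← smul_eq_mul, ← MulAction.Quotient.smul_mk,
    QuotientGroup.out_eq']

/-- A crossed homomorphism to a finite index abelian normal subgroup, restricting to a power map. -/
lemma exists_crossedHom [IsMulCommutative T] [T.FiniteIndex] :
    ∃ U : M → T, (∀ γ δ, U (γ * δ) = U γ * MulAut.conjNormal γ (U δ)) ∧
      ∀ t : T, U t = t ^ T.index := by
  have : Fintype (M ⧸ T) := Fintype.ofFinite _
  refine ⟨fun γ ↦ ∏ q : M ⧸ T, ⟨_, mul_out_mem γ q⟩, fun γ δ ↦ ?_, fun t ↦ ?_⟩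
  · beta_reduce
    rw [← Equiv.prod_comp (MulAction.toPerm δ) fun q ↦ (⟨_, mul_out_mem γ q⟩ : T), map_prod,
      ← Finset.prod_mul_distrib]
    refine Finset.prod_congr rfl fun q _ ↦ ?_
    rw [mul_comm]
    ext
    simp only [MulAction.toPerm_apply, Subgroup.coe_mul, MulAut.conjNormal_apply, mul_smul]
    group
  · have h : ∀ q : M ⧸ T, (⟨_, mul_out_mem (t : M) q⟩ : T) = t := by
      intro q
      have hq : (t : M) • q = q := by
        conv_rhs => rw [← QuotientGroup.out_eq' q]
        conv_lhs => rw [← QuotientGroup.out_eq' q]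
        rw [MulAction.Quotient.smul_mk, QuotientGroup.eq, smul_eq_mul]
        apply (inferInstance : T.Normal).mem_comm
        simp
      ext
      simp only [hq, mul_inv_cancel_right]
    beta_reduce
    rw [Finset.prod_congr rfl fun q _ ↦ h q, Finset.prod_const, Finset.card_univ,
      ← Nat.card_eq_fintype_card, Subgroup.index]

/-- An automorphism of `T` compatible with the conjugation action and a crossed homomorphism
extends to the whole group. -/
lemma exists_extension [IsMulCommutative T] [IsMulTorsionFree T]
    (hself : ∀ γ, (∀ t ∈ T, γ * t = t * γ) → γ ∈ T) {N : ℕ} (hN : N ≠ 0) {U : M → T}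
    (hU : ∀ γ δ, U (γ * δ) = U γ * MulAut.conjNormal γ (U δ)) (hUT : ∀ t : T, U t = t ^ N)
    (h : MulAut T)
    (h₁ : ∀ γ, ∃ γ', MulAut.conjNormal γ' = h * MulAut.conjNormal γ * h⁻¹ ∧ U γ' = h (U γ))
    (h₂ : ∀ γ, ∃ γ', MulAut.conjNormal γ' = h⁻¹ * MulAut.conjNormal γ * h ∧ U γ' = h⁻¹ (U γ)) :
    ∃ φ : MulAut M, ∀ t : T, φ t = h t := by
  let i : M →* T ⋊[MonoidHom.id (MulAut T)] MulAut T := MonoidHom.mk'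
    (fun γ ↦ ⟨U γ, MulAut.conjNormal γ⟩) fun γ δ ↦ by
      ext1
      · simp [hU]
      · simp
  have hi : Function.Injective i := by
    rw [injective_iff_map_eq_one]
    intro γ hγ
    have hl : U γ = 1 := congrArg SemidirectProduct.left hγ
    have hr : MulAut.conjNormal (H := T) γ = 1 := congrArg SemidirectProduct.right hγ
    have hγT : γ ∈ T := hself γ fun t ht ↦ by
      have h3 := congrArg Subtype.val (DFunLike.congr_fun hr ⟨t, ht⟩)
      rw [MulAut.conjNormal_apply] at h3
      exact mul_inv_eq_iff_eq_mul.1 h3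
    have h4 := hUT ⟨γ, hγT⟩
    rw [hl] at h4
    have h5 : (⟨γ, hγT⟩ : T) = 1 := pow_left_injective hN (by simpa using h4.symm)
    exact congrArg Subtype.val h5
  obtain ⟨φ, hφ⟩ := exists_mulAut_of_conj i hi (SemidirectProduct.inr h)
    (fun γ ↦ by
      obtain ⟨γ', ha, hb⟩ := h₁ γ
      refine ⟨γ', ?_⟩
      ext1
      · simp [i, hb]
      · simp [i, ha])
    (fun γ ↦ by
      obtain ⟨γ', ha, hb⟩ := h₂ γ
      refine ⟨γ', ?_⟩
      ext1
      · simp [i, hb]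
      · simp [i, ha])
  refine ⟨φ, fun t ↦ hi ?_⟩
  rw [hφ]
  ext1
  · have h3 : U (h t) = h (U t) := by rw [hUT, hUT, map_pow]
    simp [i, h3]
  · simp [i, conjNormal_eq_one_of_mem]

end Algebra

section Extension

open scoped IsMulCommutative

variable {M : Type*} [Group M] {T : Subgroup M} [T.Normal]

/-- Among the automorphisms of `T` conjugating the action of `M` into a given finite set, there
are only finitely many classes modulo the automorphisms extending to `M`. -/
lemma exists_finite_extendable [IsMulCommutative T] [IsMulTorsionFree T] [T.FiniteIndex]
    [Group.FG T] (hself : ∀ γ, (∀ t ∈ T, γ * t = t * γ) → γ ∈ T)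
    {S : Set (MulAut T)} (hS : S.Finite) :
    ∃ R : Set (MulAut T), R.Finite ∧ ∀ g : MulAut T,
      (∀ γ : M, g * MulAut.conjNormal γ * g⁻¹ ∈ S) →
      ∃ r ∈ R, ∃ φ : MulAut M, ∀ t : T, (φ t : M) = (r⁻¹ * g) t := by
  obtain ⟨U, hU, hUT⟩ := exists_crossedHom (T := T)
  have hN : T.index ≠ 0 := Subgroup.FiniteIndex.index_ne_zero
  have : NeZero T.index := ⟨hN⟩
  have hfin : (powMonoidHom (α := T) T.index).range.FiniteIndex :=
    Subgroup.finiteIndex_range_powMonoidHom_of_fg T hN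
  have : Finite S := hS
  let c : MulAut T → Set (S × T ⧸ (powMonoidHom (α := T) T.index).range) := fun g ↦
    {p | ∃ γ : M, g * MulAut.conjNormal γ * g⁻¹ = (p.1 : MulAut T) ∧ (QuotientGroup.mk (g (U γ))) = p.2}
  have key : ∀ g r : MulAut T, (∀ γ : M, g * MulAut.conjNormal γ * g⁻¹ ∈ S) → c r = c g →
      ∀ γ, ∃ γ' : M, MulAut.conjNormal γ' = (r⁻¹ * g) * MulAut.conjNormal γ * (r⁻¹ * g)⁻¹ ∧
        U γ' = (r⁻¹ * g) (U γ) := by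
    intro g r hg hc γ
    have h1 : ((⟨_, hg γ⟩ : S), QuotientGroup.mk (g (U γ))) ∈ c g := ⟨γ, rfl, rfl⟩
    rw [← hc] at h1
    obtain ⟨γ₁, ha, hb⟩ := h1
    dsimp only at ha hb
    rw [QuotientGroup.eq] at hb
    obtain ⟨s, hs⟩ := hb
    rw [powMonoidHom_apply] at hs
    refine ⟨(r⁻¹ s : T) * γ₁, ?_, ?_⟩
    · rw [map_mul, conjNormal_eq_one_of_mem (r⁻¹ s).2, one_mul]
      calc MulAut.conjNormal γ₁ = r⁻¹ * (r * MulAut.conjNormal γ₁ * r⁻¹) * r := by group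
        _ = _ := by rw [ha]; group
    · rw [hU, hUT, conjNormal_eq_one_of_mem (r⁻¹ s).2, ← map_pow, hs]
      simp
  obtain ⟨R, hR, hRS, h⟩ := exists_finite_representatives
    {g : MulAut T | ∀ γ : M, g * MulAut.conjNormal γ * g⁻¹ ∈ S} c
  refine ⟨R, hR, fun g hg ↦ ?_⟩
  obtain ⟨r, hr, hc⟩ := h g hg
  refine ⟨r, hr, exists_extension hself hN hU hUT _ (key g r hg hc) ?_⟩
  intro γ
  simpa [mul_inv_rev] using key r g (hRS hr) hc.symm γ

/-- Up to inner automorphisms, finitely many automorphisms are trivial on `T`. -/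
lemma finite_image_mk_trivial [IsMulCommutative T] [IsMulTorsionFree T] [T.FiniteIndex]
    [Group.FG T] (hself : ∀ γ, (∀ t ∈ T, γ * t = t * γ) → γ ∈ T) :
    (QuotientGroup.mk (s := Inn M) '' {ψ : MulAut M | ∀ t ∈ T, ψ t = t}).Finite := by
  have hN : T.index ≠ 0 := Subgroup.FiniteIndex.index_ne_zero
  have hfin : (powMonoidHom (α := T) T.index).range.FiniteIndex :=
    Subgroup.finiteIndex_range_powMonoidHom_of_fg T hN
  have : Fintype (M ⧸ T) := Fintype.ofFinite _
  have hmem : ∀ ψ : MulAut M, (∀ t ∈ T, ψ t = t) → ∀ γ, ψ γ * γ⁻¹ ∈ T := by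
    intro ψ hψ γ
    apply hself
    intro t ht
    have h1 := hψ _ ((inferInstance : T.Normal).conj_mem t ht γ⁻¹)
    have h2 := hψ t ht
    simp only [map_mul, map_inv, h2] at h1
    have h3 : t = ψ γ * (γ⁻¹ * t * γ⁻¹⁻¹) * (ψ γ)⁻¹ := by
      rw [← h1]; group
    conv_rhs => rw [h3]
    group
  classical
  let c : MulAut M → M → T := fun ψ γ ↦ if h : ψ γ * γ⁻¹ ∈ T then ⟨_, h⟩ else 1
  have hc : ∀ ψ : MulAut M, (∀ t ∈ T, ψ t = t) → ∀ γ, (c ψ γ : M) = ψ γ * γ⁻¹ := by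
    intro ψ hψ γ
    simp only [c, dif_pos (hmem ψ hψ γ)]
  let t0 : MulAut M → T := fun ψ ↦ ∏ q : M ⧸ T, c ψ q.out
  have hc_out : ∀ ψ : MulAut M, (∀ t ∈ T, ψ t = t) → ∀ γ (q : M ⧸ T),
      c ψ (γ • q).out = c ψ γ * MulAut.conjNormal γ (c ψ q.out) := by
    intro ψ hψ γ q
    have h1 := mul_out_mem (T := T) γ q
    have h2 := hψ _ h1
    simp only [map_mul, map_inv] at h2
    have h3 := congrArg Subtype.val
      (mul_comm (c ψ γ * MulAut.conjNormal γ (c ψ q.out)) (⟨_, h1⟩ : T))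
    ext
    simp only [Subgroup.coe_mul, MulAut.conjNormal_apply, hc ψ hψ] at h3 ⊢
    have h4 : ψ (γ • q).out = (γ * q.out * (γ • q).out⁻¹)⁻¹ * (ψ γ * ψ q.out) := by
      rw [← h2]; group
    rw [h4, mul_assoc, inv_mul_eq_iff_eq_mul, ← h3]
    group
  have ht0 : ∀ ψ : MulAut M, (∀ t ∈ T, ψ t = t) → ∀ γ,
      c ψ γ ^ T.index * MulAut.conjNormal γ (t0 ψ) = t0 ψ := by
    intro ψ hψ γ
    simp only [t0]
    conv_rhs => rw [← Equiv.prod_comp (MulAction.toPerm γ) fun q : M ⧸ T ↦ c ψ q.out]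
    simp only [MulAction.toPerm_apply, hc_out ψ hψ, Finset.prod_mul_distrib, map_prod]
    rw [Finset.prod_const, Finset.card_univ, ← Nat.card_eq_fintype_card, Subgroup.index]
  obtain ⟨R, hR, hRS, h⟩ := exists_finite_representatives {ψ : MulAut M | ∀ t ∈ T, ψ t = t}
    fun ψ ↦ (QuotientGroup.mk (t0 ψ) : T ⧸ (powMonoidHom (α := T) T.index).range)
  refine (hR.image (QuotientGroup.mk (s := Inn M))).subset ?_
  rintro _ ⟨ψ, hψ, rfl⟩
  obtain ⟨r, hr, hrψ⟩ := h ψ hψ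
  refine ⟨r, hr, ?_⟩
  rw [QuotientGroup.eq] at hrψ
  obtain ⟨s, hs⟩ := hrψ
  rw [powMonoidHom_apply] at hs
  have hcs : ∀ γ, c ψ γ = s * c r γ * MulAut.conjNormal γ s⁻¹ := by
    intro γ
    apply pow_left_injective hN
    beta_reduce
    have h1 := ht0 ψ hψ γ
    have h2 := ht0 r (hRS hr) γ
    have h3 : t0 ψ = t0 r * s ^ T.index := by rw [hs]; group
    rw [h3, map_mul, map_pow] at h1
    rw [mul_pow, mul_pow, ← map_pow, inv_pow, map_inv, map_pow]
    have h4 := eq_mul_inv_of_mul_eq h1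
    have h5 := eq_mul_inv_of_mul_eq h2
    rw [h4, h5, mul_inv_rev]
    generalize MulAut.conjNormal γ s ^ T.index = a
    generalize MulAut.conjNormal γ (t0 r) = b
    generalize s ^ T.index = d
    rw [mul_comm (t0 r) d]
    simp only [mul_assoc]
    rw [mul_comm a⁻¹ b⁻¹]
  have hψr : ψ = MulAut.conj (s : M) * r := by
    ext γ
    have h1 := congrArg Subtype.val (hcs γ)
    rw [Subgroup.coe_mul, Subgroup.coe_mul, MulAut.conjNormal_apply, hc ψ hψ, hc r (hRS hr)] at h1
    rw [mul_inv_eq_iff_eq_mul] at h1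
    rw [h1]
    simp [mul_assoc]
  rw [QuotientGroup.eq, hψr]
  refine (Inn.normal M).mem_comm ?_
  rw [mul_assoc, mul_inv_cancel, mul_one]
  exact ⟨_, rfl⟩

lemma finite_range_conjNormal [IsMulCommutative T] [T.FiniteIndex] :
    (Set.range (MulAut.conjNormal (H := T) : M → MulAut T)).Finite := by
  refine (Set.finite_range fun q : M ⧸ T ↦ MulAut.conjNormal (H := T) q.out).subset ?_
  rintro _ ⟨γ, rfl⟩
  refine ⟨γ, ?_⟩
  have h : (γ : M ⧸ T).out⁻¹ * γ ∈ T := by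
    rw [← QuotientGroup.eq, QuotientGroup.out_eq']
  have h1 := conjNormal_eq_one_of_mem h
  rw [map_mul, map_inv, inv_mul_eq_one] at h1
  exact h1

/-- If the automorphism group of a finitely generated torsion-free abelian normal subgroup of
finite index which is its own centralizer has finitely many conjugacy classes of finite subgroups,
then so has the outer automorphism group of the whole group. -/
lemma HasFiniteConjSet.out [IsMulCommutative T] [IsMulTorsionFree T] [T.FiniteIndex]
    [Group.FG T] (hself : ∀ γ, (∀ t ∈ T, γ * t = t * γ) → γ ∈ T)
    (hT : HasFiniteConjSet (MulAut T)) : HasFiniteConjSet (Out M) := by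
  have := characteristic_of_self_centralizing hself
  let res : MulAut M →* MulAut T := MulAut.characteristic T
  have res_apply : ∀ φ (t : T), (res φ t : M) = φ t := fun φ t ↦ rfl
  have res_conj : ∀ γ : M, res (MulAut.conj γ) = MulAut.conjNormal γ := by
    intro γ
    ext t
    rw [res_apply, MulAut.conjNormal_apply, MulAut.conj_apply]
  have hfiber : ∀ τ, (QuotientGroup.mk (s := Inn M) '' {φ : MulAut M | res φ = τ}).Finite := by
    intro τ
    by_cases hτ : ∃ φ₀, res φ₀ = τ
    · obtain ⟨φ₀, rfl⟩ := hτ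
      refine ((finite_image_mk_trivial hself).image fun x : Out M ↦ φ₀ * x).subset ?_
      rintro _ ⟨φ, hφ, rfl⟩
      refine ⟨_, ⟨φ₀⁻¹ * φ, fun t ht ↦ ?_, rfl⟩, ?_⟩
      · have h1 : res (φ₀⁻¹ * φ) = 1 := by
          rw [map_mul, map_inv, show res φ = res φ₀ from hφ, inv_mul_cancel]
        rw [← res_apply (φ₀⁻¹ * φ) ⟨t, ht⟩, h1, MulAut.one_apply]
      · beta_reduce
        rw [← QuotientGroup.mk_mul, mul_inv_cancel_left]
    · convert Set.finite_empty
      rw [Set.image_eq_empty, Set.eq_empty_iff_forall_notMem]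
      exact fun φ hφ ↦ hτ ⟨φ, hφ⟩
  obtain ⟨S, hS, hSconj⟩ := hT
  obtain ⟨R, hR, hRext⟩ := exists_finite_extendable hself hS
  refine ⟨⋃ r ∈ R, ⋃ σ ∈ S, QuotientGroup.mk (s := Inn M) '' {φ : MulAut M | res φ = r⁻¹ * σ * r},
    hR.biUnion fun r _ ↦ hS.biUnion fun σ _ ↦ hfiber _, fun F hF ↦ ?_⟩
  let K : Subgroup (MulAut T) := (F.comap (QuotientGroup.mk' (Inn M))).map res
  have hK : Finite K := by
    refine Set.Finite.subset (Set.Finite.image2 (fun a b ↦ a * b)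
      (Set.finite_range fun f : F ↦ res (f : Out M).out) (finite_range_conjNormal (T := T))) ?_
    rintro _ ⟨φ, hφ, rfl⟩
    have h1 : ((φ : Out M).out)⁻¹ * φ ∈ Inn M := by
      rw [← QuotientGroup.eq, QuotientGroup.out_eq']
    obtain ⟨γ, hγ⟩ := h1
    refine ⟨_, ⟨⟨φ, hφ⟩, rfl⟩, _, ⟨γ, rfl⟩, ?_⟩
    beta_reduce
    rw [← res_conj, hγ, ← map_mul, mul_inv_cancel_left]
  obtain ⟨g, hg⟩ := hSconj K hK
  obtain ⟨r, hr, φ, hφ⟩ := hRext g fun γ ↦ hg _ ⟨MulAut.conj γ, by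
    have h1 : QuotientGroup.mk' (Inn M) (MulAut.conj γ) = 1 :=
      (QuotientGroup.eq_one_iff _).2 ⟨γ, rfl⟩
    have h2 : QuotientGroup.mk' (Inn M) (MulAut.conj γ) ∈ F := h1 ▸ F.one_mem
    exact h2, res_conj γ⟩
  have hφres : res φ = r⁻¹ * g := by
    ext t
    rw [res_apply, hφ]
  refine ⟨(φ : Out M), fun f hf ↦ ?_⟩
  simp only [Set.mem_iUnion]
  have hfK : res f.out ∈ K := ⟨f.out, by
    have h2 : QuotientGroup.mk' (Inn M) f.out ∈ F := by
      rw [QuotientGroup.mk'_apply, QuotientGroup.out_eq']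
      exact hf
    exact h2, rfl⟩
  refine ⟨r, hr, _, hg _ hfK, φ * f.out * φ⁻¹, ?_, ?_⟩
  · rw [Set.mem_ofPred_eq, map_mul, map_mul, map_inv, hφres]
    group
  · rw [QuotientGroup.mk_mul, QuotientGroup.mk_mul, QuotientGroup.mk_inv, QuotientGroup.out_eq']

end Extension

section WellRounded

variable {Λ E κ : Type*} [AddCommGroup Λ] [NormedAddCommGroup E] [InnerProductSpace ℝ E]

/-- An equivariant embedding of `Λ` as a lattice without nonzero vectors of norm less than one. -/
structure IsLatticeEmbedding (ρ : κ → E ≃ₗᵢ[ℝ] E) (a : κ → Λ → Λ) (j : Λ →+ E) : Prop where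
  equivariant : ∀ k x, j (a k x) = ρ k (j x)
  finite_le : ∀ R : ℝ, {x | ‖j x‖ ≤ R}.Finite
  one_le : ∀ x ≠ 0, 1 ≤ ‖j x‖

/-- The vectors of norm one of an embedded lattice. -/
def unitVectors (j : Λ →+ E) : Set Λ := {x | ‖j x‖ = 1}

lemma finite_unitVectors {ρ : κ → E ≃ₗᵢ[ℝ] E} {a : κ → Λ → Λ} {j : Λ →+ E}
    (hj : IsLatticeEmbedding ρ a j) : (unitVectors j).Finite :=
  (hj.finite_le 1).subset fun _ hx ↦ le_of_eq hx

/-- Rescaling orthogonally to the span of the unit vectors creates new unit vectors, if the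
orthogonal component is not an obstruction. -/
lemma exists_finrank_span_lt [FiniteDimensional ℝ E] {ρ : κ → E ≃ₗᵢ[ℝ] E} {a : κ → Λ → Λ}
    {j : Λ →+ E} (hj : IsLatticeEmbedding ρ a j) {W : Submodule ℝ E}
    (hW : W = Submodule.span ℝ (j '' unitVectors j)) {z : Λ}
    (hz : ‖W.starProjection (j z)‖ < 1) (hzW : j z ∉ W) :
    ∃ j' : Λ →+ E, IsLatticeEmbedding ρ a j' ∧
      Module.finrank ℝ W < Module.finrank ℝ (Submodule.span ℝ (j' '' unitVectors j')) := by
  have hρW : ∀ k y, ρ k (W.starProjection y) = W.starProjection (ρ k y) := by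
    intro k y
    have hle : W.map ((ρ k).toLinearEquiv : E →ₗ[ℝ] E) ≤ W := by
      conv_lhs => rw [hW]
      rw [Submodule.map_span, Submodule.span_le]
      rintro _ ⟨_, ⟨x, hx, rfl⟩, rfl⟩
      rw [hW]
      refine Submodule.subset_span ⟨a k x, ?_, hj.equivariant k x⟩
      change ‖j (a k x)‖ = 1
      rw [hj.equivariant, LinearIsometryEquiv.norm_map]
      exact hx
    have heq : W.map ((ρ k).toLinearEquiv : E →ₗ[ℝ] E) = W :=
      Submodule.eq_of_le_of_finrank_eq hle (LinearEquiv.finrank_map_eq _ _)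
    have h := Submodule.starProjection_map_apply (ρ k) W (ρ k y)
    rw [LinearIsometryEquiv.symm_apply_apply] at h
    rw [← h]
    congr 2
  set P := W.starProjection with hP
  have hpyth : ∀ (s : ℝ) (y : E), ‖P y + s • (y - P y)‖ ^ 2 = ‖P y‖ ^ 2 + s ^ 2 * ‖y - P y‖ ^ 2 := by
    intro s y
    have h : inner ℝ (P y) (s • (y - P y)) = 0 := by
      rw [inner_smul_right, real_inner_comm,
        W.starProjection_inner_eq_zero y _ (W.starProjection_apply_mem y), mul_zero]
    rw [norm_add_sq_real, h, norm_smul, mul_pow, Real.norm_eq_abs, sq_abs]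
    ring
  have hpyth1 : ∀ y : E, ‖y‖ ^ 2 = ‖P y‖ ^ 2 + ‖y - P y‖ ^ 2 := by
    intro y
    simpa using hpyth 1 y
  have hPW : ∀ y : E, y - P y = 0 ↔ y ∈ W := by
    intro y
    rw [sub_eq_zero, eq_comm, hP, Submodule.starProjection_eq_self_iff]
  have hpos : ∀ x, j x ∉ W → 0 < ‖j x - P (j x)‖ ^ 2 := by
    intro x hx
    have h := (hPW (j x)).not.2 hx
    positivity
  let f : Λ → ℝ := fun x ↦ (1 - ‖P (j x)‖ ^ 2) / ‖j x - P (j x)‖ ^ 2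
  have hfz : 0 < f z := by
    refine div_pos ?_ (hpos z hzW)
    have := norm_nonneg (P (j z))
    nlinarith
  have hBfin : {x | ‖P (j x)‖ < 1 ∧ j x ∉ W ∧ f z ≤ f x}.Finite := by
    refine (hj.finite_le (1 + 1 / f z)).subset ?_
    rintro x ⟨h1, h2, h3⟩
    have h4 : f z * ‖j x - P (j x)‖ ^ 2 ≤ 1 := by
      have := (le_div_iff₀ (hpos x h2)).1 h3
      nlinarith [norm_nonneg (P (j x))]
    have h5 : ‖j x - P (j x)‖ ^ 2 ≤ 1 / f z := by
      rw [le_div_iff₀ hfz]; linarith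
    have h6 := hpyth1 (j x)
    have h7 : 0 < 1 / f z := by positivity
    have h8 : ‖P (j x)‖ ^ 2 ≤ 1 := by nlinarith [norm_nonneg (P (j x))]
    change ‖j x‖ ≤ _
    nlinarith [norm_nonneg (j x)]
  obtain ⟨x₀, ⟨hx₀, hx₀W, hx₀z⟩, hmax'⟩ :=
    Set.exists_max_image _ f hBfin ⟨z, hz, hzW, le_rfl⟩
  have hmax : ∀ x, ‖P (j x)‖ < 1 → j x ∉ W → f x ≤ f x₀ := by
    intro x h1 h2
    by_cases h3 : f z ≤ f x
    · exact hmax' x ⟨h1, h2, h3⟩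
    · linarith
  have ht0 : 0 < f x₀ := hfz.trans_le hx₀z
  have ht1 : f x₀ ≤ 1 := by
    rw [div_le_one (hpos x₀ hx₀W)]
    have h0 : x₀ ≠ 0 := by
      rintro rfl
      exact hx₀W (by simp)
    have h1 := hj.one_le x₀ h0
    have h2 := hpyth1 (j x₀)
    nlinarith
  have hsq : √(f x₀) ^ 2 = f x₀ := Real.sq_sqrt ht0.le
  let D : E →L[ℝ] E := P + √(f x₀) • (ContinuousLinearMap.id ℝ E - P)
  have hD : ∀ y, D y = P y + √(f x₀) • (y - P y) := fun y ↦ by simp [D]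
  let j' : Λ →+ E := (D : E →ₗ[ℝ] E).toAddMonoidHom.comp j
  have hj' : ∀ x, j' x = D (j x) := fun x ↦ rfl
  have hnorm : ∀ x, ‖j' x‖ ^ 2 = ‖P (j x)‖ ^ 2 + f x₀ * ‖j x - P (j x)‖ ^ 2 := by
    intro x
    rw [hj', hD, hpyth, hsq]
  have hDW : ∀ y ∈ W, D y = y := by
    intro y hy
    have h1 := (hPW y).2 hy
    rw [hD, h1, smul_zero, add_zero]
    exact (sub_eq_zero.1 h1).symm
  refine ⟨j', ⟨fun k x ↦ ?_, fun R ↦ ?_, fun x hx ↦ ?_⟩, ?_⟩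
  · rw [hj', hj', hD, hD, hj.equivariant, map_add, map_smul, map_sub, hρW]
  · refine (hj.finite_le (√((R ^ 2) / f x₀))).subset fun x hx ↦ ?_
    apply Real.le_sqrt_of_sq_le
    rw [le_div_iff₀ ht0]
    have h1 : ‖j' x‖ ≤ R := hx
    have h2 : ‖j' x‖ ^ 2 ≤ R ^ 2 := pow_le_pow_left₀ (norm_nonneg _) h1 2
    have h3 := hnorm x
    have h4 := hpyth1 (j x)
    nlinarith [sq_nonneg ‖P (j x)‖]
  · rw [← one_le_sq_iff₀ (norm_nonneg _), hnorm]
    by_cases h1 : ‖P (j x)‖ < 1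
    · by_cases h2 : j x ∈ W
      · have h3 := (hPW _).2 h2
        have h4 := hpyth1 (j x)
        have h5 := hj.one_le x hx
        rw [h3, norm_zero] at h4 ⊢
        nlinarith
      · have h3 := (div_le_iff₀ (hpos x h2)).1 (hmax x h1 h2)
        linarith
    · have h2 : 0 ≤ f x₀ * ‖j x - P (j x)‖ ^ 2 := by positivity
      push Not at h1
      nlinarith
  · apply Submodule.finrank_lt_finrank_of_lt
    have hle : W ≤ Submodule.span ℝ (j' '' unitVectors j') := by
      conv_lhs => rw [hW]
      rw [Submodule.span_le]
      rintro _ ⟨x, hx, rfl⟩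
      have h1 : j' x = j x := hDW _ (hW ▸ Submodule.subset_span ⟨x, hx, rfl⟩)
      refine Submodule.subset_span ⟨x, ?_, h1⟩
      change ‖j' x‖ = 1
      rw [h1]
      exact hx
    refine lt_of_le_of_ne hle fun heq ↦ hx₀W ?_
    have hx₀' : j' x₀ ∈ W := by
      rw [heq]
      refine Submodule.subset_span ⟨x₀, ?_, rfl⟩
      change ‖j' x₀‖ = 1
      rw [← pow_eq_one_iff_of_nonneg (norm_nonneg _) two_ne_zero, hnorm]
      have h1 : f x₀ * ‖j x₀ - P (j x₀)‖ ^ 2 = 1 - ‖P (j x₀)‖ ^ 2 :=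
        div_mul_cancel₀ _ (hpos x₀ hx₀W).ne'
      rw [h1]; ring
    rw [← hPW]
    have h1 := (hPW _).2 hx₀'
    have h2 : P (P (j x₀)) = P (j x₀) :=
      Submodule.starProjection_eq_self_iff.2 (W.starProjection_apply_mem _)
    rw [hj', hD, map_add, map_smul, map_sub, h2, sub_self, smul_zero, add_zero,
      add_sub_cancel_left, smul_eq_zero] at h1
    exact h1.resolve_left (Real.sqrt_pos.2 ht0).ne'

/-- Modulo the lattice generated by the unit vectors, some multiple of every lattice vector is
close to the orthogonal complement of the unit vectors. -/
lemma exists_zsmul_sub_norm_lt [FiniteDimensional ℝ E] {j : Λ →+ E} (hfin : (unitVectors j).Finite)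
    {W : Submodule ℝ E} (hW : W = Submodule.span ℝ (j '' unitVectors j)) (x : Λ) :
    ∃ k : ℤ, k ≠ 0 ∧ ∃ y ∈ AddSubgroup.closure (unitVectors j),
      ‖W.starProjection (j (k • x - y))‖ < 1 := by
  have hmem : ∀ y ∈ AddSubgroup.closure (unitVectors j), j y ∈ W := by
    intro y hy
    rw [hW]
    have h : AddSubgroup.closure (unitVectors j) ≤
        (Submodule.span ℝ (j '' unitVectors j)).toAddSubgroup.comap j := by
      rw [AddSubgroup.closure_le]
      exact fun v hv ↦ Submodule.subset_span ⟨v, hv, rfl⟩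
    exact h hy
  have happrox : ∀ w ∈ W, ∃ y ∈ AddSubgroup.closure (unitVectors j),
      ‖w - j y‖ ≤ hfin.toFinset.card := by
    intro w hw
    rw [hW, ← hfin.coe_toFinset, Submodule.mem_span_image_finset_iff_exists_fun] at hw
    obtain ⟨c, rfl⟩ := hw
    refine ⟨∑ v : hfin.toFinset, ⌊c v⌋ • v.1, ?_, ?_⟩
    · exact AddSubgroup.sum_mem _ fun v hv ↦
        AddSubgroup.zsmul_mem _ (AddSubgroup.subset_closure (hfin.mem_toFinset.1 v.2)) _
    · rw [map_sum, ← Finset.sum_sub_distrib]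
      refine (norm_sum_le_of_le _ (f := fun v ↦ c v • j v.1 - j (⌊c v⌋ • v.1)) (n := fun _ ↦ 1) ?_).trans
        (by simp)
      intro v hv
      have h1 : ‖j v.1‖ = 1 := hfin.mem_toFinset.1 v.2
      rw [map_zsmul, ← Int.cast_smul_eq_zsmul ℝ, ← sub_smul, norm_smul, h1, mul_one,
        Int.self_sub_floor, Real.norm_eq_abs, abs_of_nonneg (Int.fract_nonneg _)]
      exact (Int.fract_lt_one _).le
  choose y hy hyC using fun k : ℕ ↦ happrox _ (W.starProjection_apply_mem (j ((k : ℤ) • x)))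
  let u : ℕ → E := fun k ↦ W.starProjection (j ((k : ℤ) • x - y k))
  have hu : ∀ k, u k = W.starProjection (j ((k : ℤ) • x)) - j (y k) := by
    intro k
    simp only [u]
    rw [map_sub, map_sub, Submodule.starProjection_eq_self_iff.2 (hmem _ (hy k))]
  have hcpt := isCompact_closedBall (0 : E) hfin.toFinset.card
  obtain ⟨w, -, φ, hφ, hlim⟩ := hcpt.tendsto_subseq (x := u) fun k ↦ by
    rw [mem_closedBall_zero_iff, hu]
    exact hyC k
  obtain ⟨N, hN⟩ := Metric.cauchySeq_iff.1 hlim.cauchySeq 1 one_pos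
  refine ⟨(φ (N + 1) : ℤ) - φ N, ?_, y (φ (N + 1)) - y (φ N),
    AddSubgroup.sub_mem _ (hy _) (hy _), ?_⟩
  · have : φ N < φ (N + 1) := hφ (Nat.lt_succ_self N)
    omega
  · have h1 := hN (N + 1) (Nat.le_succ N) N le_rfl
    rw [dist_eq_norm] at h1
    have h2 : (u ∘ φ) (N + 1) - (u ∘ φ) N = W.starProjection
        (j (((φ (N + 1) : ℤ) - φ N) • x - (y (φ (N + 1)) - y (φ N)))) := by
      simp only [Function.comp_apply, u]
      rw [← map_sub, ← map_sub]
      congr 2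
      rw [sub_smul]
      abel
    rw [← h2]
    exact h1

/-- An equivariant lattice embedding can be deformed so that the vectors of minimal norm
generate a subgroup containing a multiple of every lattice vector. -/
lemma exists_wellRounded [FiniteDimensional ℝ E] {ρ : κ → E ≃ₗᵢ[ℝ] E} {a : κ → Λ → Λ}
    {j : Λ →+ E} (hj : IsLatticeEmbedding ρ a j) :
    ∃ j' : Λ →+ E, IsLatticeEmbedding ρ a j' ∧
      ∀ x, ∃ k : ℤ, k ≠ 0 ∧ k • x ∈ AddSubgroup.closure (unitVectors j') := by
  induction hn : Module.finrank ℝ E - Module.finrank ℝ (Submodule.span ℝ (j '' unitVectors j))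
    using Nat.strong_induction_on generalizing j with
  | _ n ih =>
  by_cases hex : ∃ z, ‖(Submodule.span ℝ (j '' unitVectors j)).starProjection (j z)‖ < 1 ∧
      j z ∉ Submodule.span ℝ (j '' unitVectors j)
  · obtain ⟨z, hz, hzW⟩ := hex
    obtain ⟨j', hj', hlt⟩ := exists_finrank_span_lt hj rfl hz hzW
    have hle := Submodule.finrank_le (Submodule.span ℝ (j' '' unitVectors j'))
    exact ih _ (by omega) hj' rfl
  · push Not at hex
    refine ⟨j, hj, fun x ↦ ?_⟩
    obtain ⟨k, hk, y, hy, hlt⟩ := exists_zsmul_sub_norm_lt (finite_unitVectors hj) rfl x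
    refine ⟨k, hk, ?_⟩
    have h1 := hex _ hlt
    rw [Submodule.starProjection_eq_self_iff.2 h1] at hlt
    have h2 : k • x - y = 0 := by
      by_contra h
      exact absurd hlt (not_lt.2 (hj.one_le _ h))
    rw [sub_eq_zero.1 h2]
    exact hy

end WellRounded

section FiniteSubgroups

open scoped Matrix

variable {ι : Type*} [Fintype ι]

/-- A lattice with a normed embedding without short vectors has few vectors modulo a sublattice
generated by vectors of norm at most one. -/
lemma natAbs_det_le_of_norm_le_one [DecidableEq ι] {E : Type*} [NormedAddCommGroup E] [NormedSpace ℝ E] {j : (ι → ℤ) →+ E}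
    (hj : ∀ x ≠ 0, 1 ≤ ‖j x‖) (W : Matrix ι ι ℤ) (hW : ∀ k, ‖j (W.col k)‖ ≤ 1) :
    W.det.natAbs ≤ (2 * Fintype.card ι + 1) ^ Fintype.card ι := by
  by_cases hdet : W.det = 0
  · simp [hdet]
  set m := Fintype.card ι with hm
  let f : (ι → ℤ) →ₗ[ℤ] (ι → ℤ) := W.mulVecLin
  have hf : Function.Injective f := by
    rw [← LinearMap.ker_eq_bot, LinearMap.ker_eq_bot']
    intro x hx
    exact Matrix.eq_zero_of_mulVec_eq_zero hdet hx
  have hcard : W.det.natAbs = Nat.card ((ι → ℤ) ⧸ LinearMap.range f) := by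
    rw [← Submodule.natAbs_det_equiv _ (LinearEquiv.ofInjective f hf), ← LinearMap.det_toLin']
    rfl
  have hmulVec : ∀ c : ι → ℤ, W *ᵥ c = ∑ k, c k • W.col k := by
    intro c
    simp only [Matrix.mulVec_eq_sum, op_smul_eq_smul]
    rfl
  have hsmall : ∀ x, ∃ y, ‖j y‖ ≤ m ∧ x - y ∈ LinearMap.range f := by
    intro x
    let b : ι → ℤ := W.adjugate *ᵥ x
    have hb : W *ᵥ b = W.det • x := by
      simp only [b]
      rw [Matrix.mulVec_mulVec, Matrix.mul_adjugate, Matrix.smul_mulVec, Matrix.one_mulVec]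
    refine ⟨x - W *ᵥ fun k ↦ b k / W.det, ?_, fun k ↦ b k / W.det, by simp [f]⟩
    have h1 : W.det • (x - W *ᵥ fun k ↦ b k / W.det) = W *ᵥ fun k ↦ b k % W.det := by
      rw [smul_sub, ← hb, ← Matrix.mulVec_smul, ← Matrix.mulVec_sub]
      congr 1
      ext k
      simp only [Pi.sub_apply, Pi.smul_apply, smul_eq_mul]
      rw [Int.emod_def]
    have h2 : ‖j (W *ᵥ fun k ↦ b k % W.det)‖ ≤ m * |(W.det : ℝ)| := by
      rw [hmulVec, map_sum]
      refine (norm_sum_le_of_le _ (n := fun _ ↦ |(W.det : ℝ)|) fun k _ ↦ ?_).trans (by simp [hm])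
      rw [map_zsmul, ← Int.cast_smul_eq_zsmul ℝ, norm_smul, Real.norm_eq_abs]
      have h3 : |((b k % W.det : ℤ) : ℝ)| ≤ |(W.det : ℝ)| := by
        rw [← Int.cast_abs, ← Int.cast_abs, Int.cast_le, abs_of_nonneg (Int.emod_nonneg _ hdet)]
        exact (Int.emod_lt_abs _ hdet).le
      have h4 := hW k
      have h5 := norm_nonneg (j (W.col k))
      have h6 := abs_nonneg ((b k % W.det : ℤ) : ℝ)
      nlinarith
    rw [← h1, map_zsmul, ← Int.cast_smul_eq_zsmul ℝ, norm_smul, Real.norm_eq_abs, mul_comm] at h2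
    exact le_of_mul_le_mul_right h2 (abs_pos.2 (Int.cast_ne_zero.2 hdet))
  choose y hy hyx using hsmall
  have : NeZero (2 * m + 1) := ⟨by omega⟩
  let c : ((ι → ℤ) ⧸ LinearMap.range f) → ι → ZMod (2 * m + 1) :=
    fun q i ↦ (y q.out i : ZMod (2 * m + 1))
  have hc : Function.Injective c := by
    intro p q hpq
    have h1 : ∀ i, ∃ z : ℤ, y p.out i - y q.out i = (2 * m + 1 : ℕ) * z := by
      intro i
      have h2 := congrFun hpq i
      simp only [c] at h2
      rw [eq_comm, ZMod.intCast_eq_intCast_iff_dvd_sub] at h2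
      exact h2
    choose z hz using h1
    have h2 : y p.out - y q.out = ((2 * m + 1 : ℕ) : ℤ) • z := by
      ext i
      simpa using hz i
    have h3 : z = 0 := by
      by_contra h
      have h4 := hj z h
      have h5 : ‖j (y p.out - y q.out)‖ ≤ 2 * m := by
        rw [map_sub]
        refine (norm_sub_le _ _).trans ?_
        linarith [hy p.out, hy q.out]
      rw [h2, map_zsmul, ← Int.cast_smul_eq_zsmul ℝ, norm_smul, Real.norm_eq_abs] at h5
      push_cast at h5
      rw [abs_of_nonneg (by positivity)] at h5
      have : (0 : ℝ) ≤ m := by positivity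
      nlinarith
    rw [h3, smul_zero, sub_eq_zero] at h2
    rw [← Quotient.out_eq' p, ← Quotient.out_eq' q]
    refine (Submodule.Quotient.eq _).2 ?_
    have h4 := Submodule.sub_mem _ (hyx p.out) (hyx q.out)
    rw [h2] at h4
    simpa using h4
  rw [hcard]
  refine (Nat.card_le_card_of_injective c hc).trans ?_
  rw [Nat.card_eq_fintype_card, Fintype.card_fun, ZMod.card]

lemma finite_matrix_abs_le (C : ℤ) : {A : Matrix ι ι ℤ | ∀ k l, |A k l| ≤ C}.Finite := by
  refine (Set.Finite.pi' (t := fun _ : ι ↦ {v : ι → ℤ | ∀ l, v l ∈ Set.Icc (-C) C}) fun _ ↦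
    Set.Finite.pi' fun _ ↦ Set.finite_Icc _ _).subset ?_
  exact fun A hA k l ↦ abs_le.1 (hA k l)

/-- Integral matrices of bounded nonzero determinant fall into finitely many classes modulo left
multiplication by integral matrices of determinant one. -/
lemma exists_finite_matrix_representatives [DecidableEq ι] (C : ℕ) :
    ∃ R : Set (Matrix ι ι ℤ), R.Finite ∧ (∀ r ∈ R, r.det ≠ 0) ∧
      ∀ V : Matrix ι ι ℤ, V.det ≠ 0 → V.det.natAbs ≤ C →
        ∃ r ∈ R, ∃ h : Matrix ι ι ℤ, h.det = 1 ∧ V = h * r := by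
  have : NeZero C.factorial := ⟨Nat.factorial_ne_zero _⟩
  have : NeZero (2 * C + 1) := ⟨by omega⟩
  obtain ⟨R, hR, hRp, h⟩ := exists_finite_representatives
    {V : Matrix ι ι ℤ | V.det ≠ 0 ∧ V.det.natAbs ≤ C}
    fun V ↦ ((V.det : ZMod (2 * C + 1)), V.map fun a ↦ (a : ZMod C.factorial))
  refine ⟨R, hR, fun r hr ↦ (hRp hr).1, fun V hV hVC ↦ ?_⟩
  obtain ⟨r, hr, hrV⟩ := h V ⟨hV, hVC⟩
  obtain ⟨hr0, hrC⟩ := hRp hr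
  rw [Prod.mk.injEq] at hrV
  have hdet : V.det = r.det := by
    have h1 := hrV.1
    rw [ZMod.intCast_eq_intCast_iff_dvd_sub] at h1
    have h2 := Int.eq_zero_of_abs_lt_dvd h1 (by rw [abs_lt]; constructor <;> omega)
    omega
  have hdvd : ∀ k l, ∃ a, V k l - r k l = r.det * a := by
    intro k l
    have h1 := congrFun (congrFun hrV.2 k) l
    simp only [Matrix.map_apply] at h1
    rw [ZMod.intCast_eq_intCast_iff_dvd_sub] at h1
    refine dvd_trans ?_ h1
    rw [← Int.natAbs_dvd_natAbs, Int.natAbs_natCast]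
    exact Nat.dvd_factorial (Int.natAbs_pos.2 hr0) hrC
  choose X hX using hdvd
  have hVr : V = (1 + Matrix.of X * r.adjugate) * r := by
    rw [add_mul, one_mul, mul_assoc, Matrix.adjugate_mul, Matrix.mul_smul, mul_one]
    ext k l
    simp only [Matrix.add_apply, Matrix.smul_apply, Matrix.of_apply, smul_eq_mul]
    linarith [hX k l]
  refine ⟨r, hr, _, ?_, hVr⟩
  have h1 := congrArg Matrix.det hVr
  rw [Matrix.det_mul, hdet] at h1
  exact mul_right_cancel₀ hr0 (by rw [one_mul]; exact h1.symm)

lemma exists_matrix_det_ne_zero [DecidableEq ι] {A : Set (ι → ℤ)}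
    (hA : ∀ x, ∃ k : ℤ, k ≠ 0 ∧ k • x ∈ AddSubgroup.closure A) :
    ∃ V : Matrix ι ι ℤ, V.det ≠ 0 ∧ ∀ k, V.col k ∈ A := by
  let c : (ι → ℤ) →+ (ι → ℚ) := (Int.castAddHom ℚ).compLeft ι
  have hspan : Submodule.span ℚ (c '' A) = ⊤ := by
    rw [eq_top_iff, ← (Pi.basisFun ℚ ι).span_eq, Submodule.span_le]
    rintro _ ⟨i, rfl⟩
    obtain ⟨k, hk, hkA⟩ := hA (Pi.single i 1)
    have h1 : AddSubgroup.closure A ≤ (Submodule.span ℚ (c '' A)).toAddSubgroup.comap c := by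
      rw [AddSubgroup.closure_le]
      exact fun v hv ↦ Submodule.subset_span ⟨v, hv, rfl⟩
    have h2 : c (k • Pi.single i 1) ∈ Submodule.span ℚ (c '' A) := h1 hkA
    rw [map_zsmul, ← Int.cast_smul_eq_zsmul ℚ,
      Submodule.smul_mem_iff _ (Int.cast_ne_zero.2 hk)] at h2
    have h3 : c (Pi.single i 1) = Pi.basisFun ℚ ι i := by
      ext l
      simp [c, Pi.single_apply, apply_ite]
    rw [← h3]
    exact h2
  obtain ⟨f, hfA, -, hf⟩ := Submodule.exists_fun_fin_finrank_span_eq ℚ (c '' A)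
  have hrank : Fintype.card ι = Module.finrank ℚ (Submodule.span ℚ (c '' A)) := by
    rw [hspan, finrank_top, Module.finrank_fintype_fun_eq_card]
  let e : ι ≃ Fin (Module.finrank ℚ (Submodule.span ℚ (c '' A))) := Fintype.equivFinOfCardEq hrank
  choose v hv hvf using fun i ↦ hfA (e i)
  refine ⟨(Matrix.of v)ᵀ, ?_, hv⟩
  rw [Matrix.det_transpose]
  have h1 : LinearIndependent ℚ ((Matrix.of v).map (Int.castRingHom ℚ)).row := by
    have h2 : ((Matrix.of v).map (Int.castRingHom ℚ)).row = f ∘ e := funext hvf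
    rw [h2]
    exact hf.comp e e.injective
  rw [Matrix.linearIndependent_rows_iff_isUnit, Matrix.isUnit_iff_isUnit_det] at h1
  intro h2
  have h3 : (Int.castRingHom ℚ) (Matrix.of v).det = 0 := by rw [h2, map_zero]
  rw [RingHom.map_det] at h3
  exact h1.ne_zero h3

/-- A finite group of integral matrices has a well-rounded lattice, providing an integral matrix
conjugating it into bounded matrices. -/
lemma exists_matrix_adjugate_mul_bounded [DecidableEq ι] (F : Subgroup (Matrix ι ι ℤ)ˣ) [Finite F] :
    ∃ V : Matrix ι ι ℤ, V.det ≠ 0 ∧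
      V.det.natAbs ≤ (2 * Fintype.card ι + 1) ^ Fintype.card ι ∧
      ∀ g ∈ F, ∀ k l, |(V.adjugate * g * V) k l| ≤
        ((2 * Fintype.card ι + 1) ^ Fintype.card ι : ℕ) := by
  have : Fintype F := Fintype.ofFinite F
  let a : F → (ι → ℤ) → (ι → ℤ) := fun g x ↦ (g : (Matrix ι ι ℤ)ˣ).1 *ᵥ x
  let j : (ι → ℤ) →+ EuclideanSpace ℝ (F × ι) := AddMonoidHom.mk'
    (fun x ↦ WithLp.toLp 2 fun p ↦ (a p.1 x p.2 : ℝ)) fun x y ↦ by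
      ext p
      simp [a, Matrix.mulVec_add]
  have hj_apply : ∀ x p, j x p = (a p.1 x p.2 : ℝ) := fun x p ↦ rfl
  let ρ : F → EuclideanSpace ℝ (F × ι) ≃ₗᵢ[ℝ] EuclideanSpace ℝ (F × ι) := fun g ↦
    LinearIsometryEquiv.piLpCongrLeft 2 ℝ ℝ
      ((Equiv.mulRight g).prodCongr (Equiv.refl ι)).symm
  have hcoord : ∀ x i, (x i : ℝ) = j x (1, i) := fun x i ↦ by simp [hj_apply, a]
  have hj : IsLatticeEmbedding ρ a j := by
    refine ⟨fun g x ↦ ?_, fun R ↦ ?_, fun x hx ↦ ?_⟩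
    · ext p
      simp [ρ, hj_apply, a, LinearIsometryEquiv.piLpCongrLeft_apply, Equiv.piCongrLeft'_apply]
    · refine (Set.Finite.pi' (t := fun _ : ι ↦ Set.Icc (-⌈R⌉) ⌈R⌉)
        fun _ ↦ Set.finite_Icc _ _).subset fun x hx i ↦ abs_le.1 ?_
      have h1 := (PiLp.norm_apply_le (j x) (1, i)).trans hx
      rw [← hcoord, Real.norm_eq_abs, ← Int.cast_abs] at h1
      exact_mod_cast h1.trans (Int.le_ceil R)
    · obtain ⟨i, hi⟩ := Function.ne_iff.1 hx
      refine le_trans ?_ (PiLp.norm_apply_le (j x) (1, i))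
      rw [← hcoord, Real.norm_eq_abs, ← Int.cast_abs]
      exact_mod_cast Int.one_le_abs hi
  obtain ⟨j', hj', hspan⟩ := exists_wellRounded hj
  obtain ⟨V, hV, hVA⟩ := exists_matrix_det_ne_zero hspan
  have hV1 : ∀ k, ‖j' (V.col k)‖ ≤ 1 := fun k ↦ le_of_eq (hVA k)
  refine ⟨V, hV, natAbs_det_le_of_norm_le_one hj'.one_le V hV1, fun g hg k l ↦ ?_⟩
  have h1 : (V.adjugate * g * V) k l = (V.updateCol k (g.1 *ᵥ V.col l)).det := by
    rw [← Matrix.cramer_apply, Matrix.cramer_eq_adjugate_mulVec, Matrix.mulVec_mulVec]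
    rfl
  rw [h1, Int.abs_eq_natAbs, Int.ofNat_le]
  refine natAbs_det_le_of_norm_le_one hj'.one_le _ fun k' ↦ ?_
  by_cases hk : k' = k
  · subst hk
    have h2 : (V.updateCol k' (g.1 *ᵥ V.col l)).col k' = a ⟨g, hg⟩ (V.col l) := by
      ext i
      simp [a]
    rw [h2, hj'.equivariant, LinearIsometryEquiv.norm_map]
    exact hV1 l
  · have h2 : (V.updateCol k (g.1 *ᵥ V.col l)).col k' = V.col k' := by
      ext i
      simp [hk]
    rw [h2]
    exact hV1 k'

/-- **Jordan–Zassenhaus** for finite groups of integral matrices. -/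
theorem hasFiniteConjSet_units_matrix [DecidableEq ι] : HasFiniteConjSet (Matrix ι ι ℤ)ˣ := by
  set C := (2 * Fintype.card ι + 1) ^ Fintype.card ι
  obtain ⟨R, hR, hR0, h⟩ := exists_finite_matrix_representatives (ι := ι) C
  refine ⟨⋃ r ∈ R, {g | ∀ k l, |(r.adjugate * g * r) k l| ≤ C}, hR.biUnion fun r hr ↦ ?_,
    fun F hF ↦ ?_⟩
  · refine Set.Finite.of_finite_image (f := fun g : (Matrix ι ι ℤ)ˣ ↦ r.adjugate * g.1 * r)
      ((finite_matrix_abs_le C).subset ?_) ?_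
    · rintro _ ⟨g, hg, rfl⟩
      exact hg
    · intro g _ g' _ hgg'
      have h1 := congrArg (fun A ↦ r * A * r.adjugate) hgg'
      simp only [← mul_assoc, Matrix.mul_adjugate] at h1
      simp only [mul_assoc, Matrix.mul_adjugate, Matrix.smul_mul, Matrix.mul_smul, one_mul,
        mul_one] at h1
      ext k l
      have h2 := congrFun (congrFun h1 k) l
      simpa only [Matrix.smul_apply, smul_eq_mul, mul_eq_mul_left_iff, hR0 r hr, or_false] using h2
  · obtain ⟨V, hV, hVC, hVF⟩ := exists_matrix_adjugate_mul_bounded F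
    obtain ⟨r, hr, A, hA, rfl⟩ := h V hV hVC
    have hA1 : A.adjugate * A = 1 := by rw [Matrix.adjugate_mul, hA, one_smul]
    have hA2 : A * A.adjugate = 1 := by rw [Matrix.mul_adjugate, hA, one_smul]
    refine ⟨⟨A.adjugate, A, hA1, hA2⟩, fun f hf ↦ ?_⟩
    simp only [Set.mem_iUnion]
    refine ⟨r, hr, fun k l ↦ ?_⟩
    have h1 := hVF f hf k l
    rw [Matrix.adjugate_mul_distrib] at h1
    simpa only [Units.val_mul, Units.inv_mk, mul_assoc] using h1

end FiniteSubgroups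

section Finiteness

/-- The automorphism group of a finitely generated torsion-free abelian group has finitely many
conjugacy classes of finite subgroups. -/
lemma hasFiniteConjSet_mulAut (A : Type*) [CommGroup A] [Group.FG A] [IsMulTorsionFree A] :
    HasFiniteConjSet (MulAut A) := by
  have : Module.Finite ℤ (Additive A) := Module.Finite.iff_addGroup_fg.2 inferInstance
  have : Module.Free ℤ (Additive A) := inferInstance
  let b := Module.Free.chooseBasis ℤ (Additive A)
  let e₁ : (Additive A ≃ₗ[ℤ] Additive A) ≃* MulAut A :=
    { toFun := fun f ↦ AddEquiv.toMultiplicative f.toAddEquiv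
      invFun := fun f ↦ (MulEquiv.toAdditive f).toIntLinearEquiv
      left_inv := fun f ↦ rfl
      right_inv := fun f ↦ rfl
      map_mul' := fun f g ↦ rfl }
  let e₂ := Units.mapEquiv (LinearMap.toMatrixAlgEquiv b).symm.toMulEquiv
  exact (hasFiniteConjSet_units_matrix.of_mulEquiv e₂).of_mulEquiv
    ((LinearMap.GeneralLinearGroup.generalLinearEquiv ℤ (Additive A)).trans e₁)

open scoped IsMulCommutative

/-- The outer automorphism group of a space group has finitely many conjugacy classes of finite
subgroups. -/
lemma IsSpaceGroup.hasFiniteConjSet_out {m : ℕ}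
    {M : Subgroup (EuclideanSpace ℝ (Fin m) ≃ᵢ EuclideanSpace ℝ (Fin m))} (hM : IsSpaceGroup M) :
    HasFiniteConjSet (Out M) := by
  have := hM.group_fg
  have := hM.finiteIndex_translations
  have : IsMulCommutative (translations M) :=
    ⟨⟨fun s t ↦ Subtype.ext (translations_comm s.2 t.2)⟩⟩
  have : IsMulTorsionFree (translations M) := by
    refine ⟨fun k hk s t hst ↦ ?_⟩
    have h : ((s / t : translations M) : M) ^ k = 1 := by
      rw [← Subgroup.coe_pow, div_pow, show s ^ k = t ^ k from hst, div_self', Subgroup.coe_one]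
    exact div_eq_one.1 (Subtype.ext (translations_pow_eq_one (s / t).2 hk h))
  exact HasFiniteConjSet.out (fun γ ↦ hM.mem_translations_of_commute)
    (hasFiniteConjSet_mulAut (translations M))

/-- Homomorphisms with finite image from a finitely generated group to a group with finitely many
conjugacy classes of finite subgroups are finite in number up to conjugation. -/
lemma HasFiniteConjSet.exists_finite_monoidHom {D G : Type*} [Group D] [Group G] [Group.FG D]
    (hG : HasFiniteConjSet G) :
    ∃ S : Set (D →* G), S.Finite ∧ (∀ η ∈ S, (Set.range η).Finite) ∧
      ∀ η : D →* G, (Set.range η).Finite → ∃ η' ∈ S, ∃ g : G, ∀ δ, η δ = g * η' δ * g⁻¹ := by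
  obtain ⟨S, hS, h⟩ := hG
  obtain ⟨B, hB⟩ := (Group.fg_def (G := D)).1 inferInstance
  refine ⟨{η | ∀ δ, η δ ∈ S}, ?_, fun η hη ↦ hS.subset (Set.range_subset_iff.2 hη), fun η hη ↦ ?_⟩
  · refine Set.Finite.of_finite_image (f := fun (η : D →* G) (b : B) ↦ η b)
      ((Set.Finite.pi' (t := fun _ : B ↦ S) fun _ ↦ hS).subset ?_) ?_
    · rintro _ ⟨η, hη, rfl⟩ b
      exact hη b
    · intro η _ η' _ hηη'
      exact MonoidHom.eq_of_eqOn_dense hB fun b hb ↦ congrFun hηη' ⟨b, hb⟩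
  · obtain ⟨g, hg⟩ := h η.range hη
    refine ⟨(MulAut.conj g).toMonoidHom.comp η, fun δ ↦ hg _ ⟨δ, rfl⟩, g⁻¹, fun δ ↦ ?_⟩
    simp [mul_assoc]

end Finiteness

/-- **Lemma 4**: for an `m`-space group `M` and an `(n-m)`-space group `Δ`, the set
`Out(Δ, M) = (Out(M)\Hom_f(Δ, Out(M)))/Out(Δ)` is finite: there are finitely many
homomorphisms `Δ → Out(M)` with finite image, up to conjugation in `Out(M)` and
precomposition with automorphisms of `Δ`. -/
theorem out_delta_M_finite {n m : ℕ} (hm : 0 < m) (hmn : m < n)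
    (M : Subgroup (EuclideanSpace ℝ (Fin m) ≃ᵢ EuclideanSpace ℝ (Fin m)))
    (hM : IsSpaceGroup M)
    (Δ : Subgroup (EuclideanSpace ℝ (Fin (n - m)) ≃ᵢ EuclideanSpace ℝ (Fin (n - m))))
    (hΔ : IsSpaceGroup Δ) :
    ∃ S : Set (Δ →* Out M), S.Finite ∧
      (∀ η ∈ S, (Set.range η).Finite) ∧
      ∀ η : Δ →* Out M, (Set.range η).Finite →
        ∃ η' ∈ S, ∃ (g : Out M) (β : MulAut Δ),
          ∀ δ : Δ, η δ = g * η' (β δ) * g⁻¹ := by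
  have := hΔ.group_fg
  obtain ⟨S, hS, hfin, h⟩ := hM.hasFiniteConjSet_out.exists_finite_monoidHom (D := Δ)
  refine ⟨S, hS, hfin, fun η hη ↦ ?_⟩
  obtain ⟨η', hη', g, hg⟩ := h η hη
  exact ⟨η', hη', g, 1, hg⟩
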